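/- arXiv:1703.03069 — 2 statements merged into one kernel-verified Lean document; each statement's English description precedes it below -/
import Mathlib

section
/- (sds implies strictly upper semismooth) Let Ω be a nonempty open convex subset of a real Banach space X, let ∂ be a subdifferential (an operator satisfying ∂_MR f ⊆ ∂f ⊆ ∂_C f and the Separation Principle), and let f : X → (−∞,+∞] be proper lower semicontinuous with Ω ∩ dom f ≠ ∅. If f is ∂-subdifferentially and directionally stable (sds) on Ω, then for every x̄ ∈ Ω ∩ dom ∂f, every u ∈ X with u ≠ 0 and x̄ + u ∈ Ω ∩ dom f, and every t ∈ [0,1), the function f is strictly upper semismooth at x̄ + tu in the direction u and the radial subderivative f^r(x̄ + tu; u) is finite. -/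
open Filter Topology Set

noncomputable section

variable {X : Type*} [NormedAddCommGroup X] [NormedSpace ℝ X]

/-- The difference quotient `(f(x + t·u) − f(x))/t` as an extended real. -/
def erSlope (f : X → EReal) (x u : X) (t : ℝ) : EReal :=
  (f (x + t • u) - f x) * ((t⁻¹ : ℝ) : EReal)

/-- The (lower right Dini) radial subderivative `f^r(x;u)`. -/
def radialSub (f : X → EReal) (x u : X) : EReal :=
  Filter.liminf (erSlope f x u) (𝓝[>] (0:ℝ))

/-- The upper radial subderivative `f^r_+(x;u)`. -/
def radialSubPlus (f : X → EReal) (x u : X) : EReal :=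
  Filter.limsup (erSlope f x u) (𝓝[>] (0:ℝ))

/-- The (lower right Dini-Hadamard) directional subderivative `f^d(x;u)`. -/
def dirSub (f : X → EReal) (x u : X) : EReal :=
  Filter.liminf (fun p : ℝ × X => (f (x + p.1 • p.2) - f x) * ((p.1⁻¹ : ℝ) : EReal))
    ((𝓝[>] (0:ℝ)) ×ˢ 𝓝 u)

/-- The Clarke-Rockafellar subderivative `f^↑(x;u)`. -/
def crSub (f : X → EReal) (x u : X) : EReal :=
  ⨆ δ ∈ Set.Ioi (0:ℝ),
    Filter.limsup
      (fun p : X × ℝ =>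
        ⨅ u' ∈ Metric.ball u δ, (f (p.1 + p.2 • u') - f p.1) * ((p.2⁻¹ : ℝ) : EReal))
      ((𝓝 x ⊓ Filter.comap f (𝓝 (f x))) ×ˢ 𝓝[>] (0:ℝ))

/-- The Clarke subderivative `f^0(x;u)`. -/
def clarkeSub (f : X → EReal) (x u : X) : EReal :=
  Filter.limsup (fun p : X × ℝ => (f (p.1 + p.2 • u) - f p.1) * ((p.2⁻¹ : ℝ) : EReal))
    (𝓝 x ×ˢ 𝓝[>] (0:ℝ))

/-- The directional limsup `limsup_{x →_v xbar} h(x) :=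
`lim_{δ↘0} sup { h(xbar + t v') : 0 < t < δ, ‖v' − v‖ < δ }`. -/
def dirLimsup (h : X → EReal) (x v : X) : EReal :=
  ⨅ δ ∈ Set.Ioi (0:ℝ), ⨆ t ∈ Set.Ioo (0:ℝ) δ, ⨆ v' ∈ Metric.ball v δ, h (x + t • v')

/-- The ordinary limsup `limsup_{x → xbar} h(x) := lim_{δ↘0} sup { h(x) : 0 < ‖x − xbar‖ < δ }`. -/
def ptLimsup (h : X → EReal) (x : X) : EReal :=
  ⨅ δ ∈ Set.Ioi (0:ℝ), ⨆ y ∈ {y : X | 0 < ‖y - x‖ ∧ ‖y - x‖ < δ}, h y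

/-- `f` is upper semismooth at `x` in the direction `u`. -/
def UpperSemismooth (f : X → EReal) (x u : X) : Prop :=
  ⨅ α ∈ Set.Ici (0:ℝ), dirLimsup (fun y => radialSub f y (u + α • (x - y))) x u
    ≤ radialSub f x u

/-- `f` is strictly upper semismooth at `x` in the direction `u`. -/
def StrictUpperSemismooth (f : X → EReal) (x u : X) : Prop :=
  ⨅ α ∈ Set.Ici (0:ℝ), ptLimsup (fun y => radialSub f y (u + α • (x - y))) x
    ≤ radialSub f x u

/-- `f` is radially accessible at `x` from the direction `u`. -/
def RadiallyAccessible (f : X → EReal) (x u : X) : Prop :=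
  f x = Filter.liminf (fun t : ℝ => f (x + t • u)) (𝓝[>] (0:ℝ))

/-- A proper lower semicontinuous function `X → (−∞,+∞]`. -/
def ProperLsc (f : X → EReal) : Prop :=
  LowerSemicontinuous f ∧ (∃ x, f x ≠ ⊤) ∧ ∀ x, f x ≠ ⊥

/-- Convexity for extended-real-valued functions. -/
def ERealConvexOn (f : X → EReal) : Prop :=
  ∀ x y : X, ∀ a b : ℝ, 0 ≤ a → 0 ≤ b → a + b = 1 →
    f (a • x + b • y) ≤ (a : EReal) * f x + (b : EReal) * f y

/-- `f` is (finite and) Lipschitz near `x`. -/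
def ERealLipschitzNear (f : X → EReal) (x : X) : Prop :=
  ∃ (K ε : ℝ), 0 < ε ∧ (∀ y ∈ Metric.ball x ε, f y ≠ ⊤ ∧ f y ≠ ⊥) ∧
    ∀ y ∈ Metric.ball x ε, ∀ z ∈ Metric.ball x ε,
      f y ≤ f z + ((K * ‖y - z‖ : ℝ) : EReal)

/-- The Moreau-Rockafellar subdifferential. -/
def mrSubdiff (f : X → EReal) (x : X) : Set (X →L[ℝ] ℝ) :=
  {p | ∀ y : X, ((p (y - x) : ℝ) : EReal) + f x ≤ f y}

/-- The Clarke subdifferential, associated to the Clarke-Rockafellar subderivative. -/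
def clarkeSubdiff (f : X → EReal) (x : X) : Set (X →L[ℝ] ℝ) :=
  {p | ∀ u : X, ((p u : ℝ) : EReal) ≤ crSub f x u}

/-- The set `∂̂f(xbar)` of weak* limits of nets of subgradients at nearby points
(nets being encoded by filters on the product `X × X*`). -/
def hatSubdiff (S : X → Set (X →L[ℝ] ℝ)) (f : X → EReal) (x : X) : Set (X →L[ℝ] ℝ) :=
  {p | ∃ l : Filter (X × (X →L[ℝ] ℝ)), l.NeBot ∧ (∀ᶠ q in l, q.2 ∈ S q.1) ∧
        Filter.Tendsto (fun q : X × (X →L[ℝ] ℝ) => q.1) l (𝓝 x) ∧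
        Filter.Tendsto (fun q : X × (X →L[ℝ] ℝ) => f q.1) l (𝓝 (f x)) ∧
        (∀ w : X, Filter.Tendsto (fun q : X × (X →L[ℝ] ℝ) => q.2 w) l (𝓝 (p w))) ∧
        Filter.limsup (fun q : X × (X →L[ℝ] ℝ) => ((q.2 (q.1 - x) : ℝ) : EReal)) l ≤ 0}

/-- A subdifferential: an operator `∂` with `∂_MR f ⊆ ∂f ⊆ ∂_C f` for every proper lsc `f`,
satisfying the Separation Principle (SP). -/
structure Subdifferential (X : Type*) [NormedAddCommGroup X] [NormedSpace ℝ X] where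
  sub : (X → EReal) → X → Set (X →L[ℝ] ℝ)
  mr_subset : ∀ f : X → EReal, ProperLsc f → ∀ x, mrSubdiff f x ⊆ sub f x
  subset_clarke : ∀ f : X → EReal, ProperLsc f → ∀ x, sub f x ⊆ clarkeSubdiff f x
  separation : ∀ (f φ : X → EReal) (x : X), ProperLsc f → ProperLsc φ →
    ERealConvexOn φ → ERealLipschitzNear φ x → f x ≠ ⊤ →
    (∀ᶠ y in 𝓝 x, f x + φ x ≤ f y + φ y) →
    ∃ p₁ ∈ hatSubdiff (sub f) f x, ∃ p₂ ∈ sub φ x, p₁ + p₂ = 0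

/-- The subderivative associated to a subdifferential: the support function
`f^∂(x;u) := sup {⟨x*, u⟩ : x* ∈ ∂f(x)}`. -/
def supportSub (S : X → Set (X →L[ℝ] ℝ)) (x u : X) : EReal :=
  ⨆ p ∈ S x, ((p u : ℝ) : EReal)

/-- Lower right Dini derivative `ψ^r(t₀;+1)` of `ψ : ℝ → [−∞,+∞]`. -/
def diniLower (ψ : ℝ → EReal) (t₀ : ℝ) : EReal :=
  Filter.liminf (fun t : ℝ => (ψ (t₀ + t) - ψ t₀) * ((t⁻¹ : ℝ) : EReal)) (𝓝[>] (0:ℝ))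

/-- Upper right Dini derivative `ψ^r_+(t₀;+1)` of `ψ : ℝ → [−∞,+∞]`. -/
def diniUpper (ψ : ℝ → EReal) (t₀ : ℝ) : EReal :=
  Filter.limsup (fun t : ℝ => (ψ (t₀ + t) - ψ t₀) * ((t⁻¹ : ℝ) : EReal)) (𝓝[>] (0:ℝ))

end

/-- `g` is `∂`-subdifferentially and directionally stable (sds) on `Ω`, where `S = ∂g`.
Writing `y = a + s•(b−a)` for `y ∈ [a,b)`, `w = y + r•(b−a)` and `x₀ = y + (σr)•(b−a)`
for `x₀ ∈ [y,w)`. -/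
def SDS {X : Type*} [NormedAddCommGroup X] [NormedSpace ℝ X]
    (S : X → Set (X →L[ℝ] ℝ)) (g : X → EReal) (Ω : Set X) : Prop :=
  ∀ a ∈ Ω, (S a).Nonempty → ∀ b ∈ Ω, g b ≠ ⊤ → b ≠ a →
    ((∀ t ∈ Set.Icc (0:ℝ) 1, g (a + t • (b - a)) ≠ ⊤ ∧ g (a + t • (b - a)) ≠ ⊥) ∧
     ContinuousOn (fun t : ℝ => g (a + t • (b - a))) (Set.Icc (0:ℝ) 1) ∧
     (∀ t ∈ Set.Ico (0:ℝ) 1, ∃ d : EReal, d < ⊤ ∧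
        Filter.Tendsto (fun s : ℝ =>
            (g (a + (t + s) • (b - a)) - g (a + t • (b - a))) * ((s⁻¹ : ℝ) : EReal))
          (𝓝[>] (0:ℝ)) (𝓝 d)) ∧
     (∀ s ∈ Set.Ico (0:ℝ) 1, ∀ ε : ℝ, 0 < ε → ∃ r₀ ∈ Set.Ioo (0:ℝ) 1,
        ∀ r ∈ Set.Ioc (0:ℝ) r₀, ∀ σ ∈ Set.Ico (0:ℝ) 1,
          ∀ y w x₀ : X, y = a + s • (b - a) → w = y + r • (b - a) →
            x₀ = y + (σ * r) • (b - a) →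
          ∀ (xs : ℕ → X) (ps : ℕ → X →L[ℝ] ℝ),
            (∀ n, ps n ∈ S (xs n)) → Filter.Tendsto xs atTop (𝓝 x₀) →
            Filter.limsup (fun n => (((ps n) (w - xs n) : ℝ) : EReal)) atTop
              ≤ radialSub g y (w - x₀) + ((ε * ‖w - x₀‖ : ℝ) : EReal)))

/-- Ekeland's variational principle in a complete metric space. -/
theorem exists_ekeland_point {M : Type*} [MetricSpace M] [CompleteSpace M] {G : M → ℝ}
    (hG : LowerSemicontinuous G) (hbdd : BddBelow (range G)) (x₀ : M) {ε : ℝ} (hε : 0 < ε) :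
    ∃ x, G x + ε * dist x x₀ ≤ G x₀ ∧ ∀ y, G x ≤ G y + ε * dist y x := by
  let S : M → Set M := fun x => {y | G y + ε * dist y x ≤ G x}
  have hself : ∀ x, x ∈ S x := fun x => by simp [S]
  have htrans : ∀ x y z, y ∈ S x → z ∈ S y → z ∈ S x := fun x y z hy hz => by
    simp only [S, mem_ofPred] at *
    nlinarith [dist_triangle z y x]
  have hclosed : ∀ x, IsClosed (S x) := fun x => by
    have h : LowerSemicontinuous fun y => G y + ε * dist y x :=
      hG.add (Continuous.lowerSemicontinuous (by fun_prop))
    exact lowerSemicontinuous_iff_isClosed_preimage.1 h (G x)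
  have hbS : ∀ x, BddBelow (G '' S x) := fun x => hbdd.mono (image_subset_range _ _)
  have hnext : ∀ (n : ℕ) (x : M), ∃ y ∈ S x, G y < sInf (G '' S x) + (1 / 2 : ℝ) ^ n := by
    intro n x
    obtain ⟨_, ⟨y, hy, rfl⟩, h⟩ := Real.lt_sInf_add_pos (s := G '' S x)
      ⟨_, mem_image_of_mem _ (hself x)⟩ (ε := (1 / 2 : ℝ) ^ n) (by positivity)
    exact ⟨y, hy, h⟩
  choose g hgS hgI using hnext
  let s : ℕ → M := fun n => Nat.rec x₀ (fun k x => g k x) n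
  have hs : ∀ n, s (n + 1) = g n (s n) := fun n => rfl
  have hmono : ∀ n m, n ≤ m → s m ∈ S (s n) := by
    intro n m h
    induction m, h using Nat.le_induction with
    | base => exact hself _
    | succ k _ ih => exact htrans _ _ _ ih (by rw [hs]; exact hgS _ _)
  have hsmall : ∀ n, ∀ y ∈ S (s (n + 1)), ε * dist y (s (n + 1)) ≤ (1 / 2 : ℝ) ^ n := by
    intro n y hy
    have h1 : y ∈ S (s n) := htrans _ _ _ (hmono n (n + 1) n.le_succ) hy
    have h2 := csInf_le (hbS (s n)) (mem_image_of_mem G h1)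
    have h3 := hgI n (s n)
    rw [← hs] at h3
    simp only [S, mem_ofPred] at hy
    linarith
  have hpow : Tendsto (fun n : ℕ => (1 / 2 : ℝ) ^ n / ε) atTop (𝓝 0) := by
    simpa using (tendsto_pow_atTop_nhds_zero_of_lt_one (by norm_num : (0 : ℝ) ≤ 1 / 2)
      (by norm_num)).div_const ε
  have hcauchy : CauchySeq fun n => s (n + 1) := by
    refine cauchySeq_of_le_tendsto_0' _ (fun n m h => ?_) hpow
    rw [le_div_iff₀ hε, mul_comm, dist_comm]
    exact hsmall n _ (hmono (n + 1) (m + 1) (by omega))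
  obtain ⟨x, hx⟩ := cauchySeq_tendsto_of_complete hcauchy
  have hxS : ∀ n, x ∈ S (s n) := fun n =>
    (hclosed _).mem_of_tendsto hx (eventually_atTop.2 ⟨n, fun m hm => hmono n (m + 1) (by omega)⟩)
  refine ⟨x, hxS 0, fun y => ?_⟩
  by_contra! hy
  have hyS : y ∈ S x := hy.le
  have hlim : Tendsto (fun n => s (n + 1)) atTop (𝓝 y) := by
    rw [tendsto_iff_dist_tendsto_zero]
    refine squeeze_zero (fun _ => dist_nonneg) (fun n => ?_) hpow
    rw [le_div_iff₀ hε, mul_comm, dist_comm]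
    exact hsmall n y (htrans _ _ _ (hxS (n + 1)) hyS)
  obtain rfl := tendsto_nhds_unique hx hlim
  simp at hy

/-- The distance to a convex set is convex. -/
theorem convexOn_infDist_of_convex {E : Type*} [NormedAddCommGroup E] [NormedSpace ℝ E]
    {s : Set E} (hs : Convex ℝ s) (hne : s.Nonempty) :
    ConvexOn ℝ univ fun x => Metric.infDist x s := by
  refine ⟨convex_univ, fun x _ y _ a b ha hb hab => le_of_forall_pos_lt_add fun δ hδ => ?_⟩
  obtain ⟨p, hp, hxp⟩ := (Metric.infDist_lt_iff hne).1 (lt_add_of_pos_right (Metric.infDist x s) hδ)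
  obtain ⟨q, hq, hyq⟩ := (Metric.infDist_lt_iff hne).1 (lt_add_of_pos_right (Metric.infDist y s) hδ)
  refine (Metric.infDist_le_dist_of_mem (hs hp hq ha hb hab)).trans_lt ?_
  have h : dist (a • x + b • y) (a • p + b • q) ≤ a * dist x p + b * dist y q := by
    refine (dist_add_add_le _ _ _ _).trans_eq ?_
    rw [dist_smul₀, dist_smul₀, Real.norm_of_nonneg ha, Real.norm_of_nonneg hb]
  refine h.trans_lt ?_
  simp only [smul_eq_mul]
  rcases ha.eq_or_lt with rfl | ha
  · have : b = 1 := by linarith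
    subst this; linarith
  · nlinarith [mul_lt_mul_of_pos_left hxp ha, mul_le_mul_of_nonneg_left hyq.le hb]

/-- Clarke subgradients of a Lipschitz convex function satisfy the subgradient inequality. -/
theorem apply_sub_le_of_mem_clarkeSubdiff {X : Type*} [NormedAddCommGroup X] [NormedSpace ℝ X]
    {φ : X → ℝ} (hφ : ConvexOn ℝ univ φ) (hc : Continuous φ) {x : X} {p : X →L[ℝ] ℝ}
    (hp : p ∈ clarkeSubdiff (fun y => (φ y : EReal)) x) (w : X) :
    p (w - x) ≤ φ w - φ x := by
  suffices h : crSub (fun y => (φ y : EReal)) x (w - x) ≤ ((φ w - φ x : ℝ) : EReal) by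
    exact_mod_cast (hp (w - x)).trans h
  refine iSup₂_le fun δ hδ => ?_
  let l := (𝓝 x ⊓ comap (fun y => (φ y : EReal)) (𝓝 (φ x : EReal))) ×ˢ 𝓝[>] (0 : ℝ)
  have hl : l ≤ 𝓝 x ×ˢ 𝓝[>] (0 : ℝ) := Filter.prod_mono inf_le_left le_rfl
  have hlim : Tendsto (fun q : X × ℝ => ((φ (q.1 + (w - x)) - φ q.1 : ℝ) : EReal)) l
      (𝓝 ((φ w - φ x : ℝ) : EReal)) := by
    have h1 : Tendsto (fun q : X × ℝ => q.1) l (𝓝 x) := tendsto_fst.mono_left hl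
    have h2 : Continuous fun y : X => ((φ (y + (w - x)) - φ y : ℝ) : EReal) :=
      continuous_coe_real_ereal.comp (by fun_prop)
    simpa [Function.comp_def] using (h2.tendsto x).comp h1
  have hne : l.NeBot := by
    refine Filter.prod_neBot.2 ⟨?_, inferInstance⟩
    refine (inferInstance : (pure x : Filter X).NeBot).mono (le_inf (pure_le_nhds x) ?_)
    exact tendsto_iff_comap.1 (tendsto_pure_nhds _ _)
  refine (limsup_le_limsup ?_).trans_eq hlim.limsup_eq
  have h01 : ∀ᶠ q : X × ℝ in l, q.2 ∈ Ioo (0 : ℝ) 1 :=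
    (tendsto_snd.mono_left hl).eventually (Ioo_mem_nhdsGT one_pos)
  filter_upwards [h01] with q hq
  refine (iInf₂_le (w - x) (Metric.mem_ball_self hδ)).trans ?_
  rw [← EReal.coe_sub, ← EReal.coe_mul, EReal.coe_le_coe_iff, ← div_eq_mul_inv, div_le_iff₀ hq.1]
  have := hφ.2 (mem_univ q.1) (mem_univ (q.1 + (w - x))) (sub_nonneg.2 hq.2.le) hq.1.le (by ring)
  have e : (1 - q.2) • q.1 + q.2 • (q.1 + (w - x)) = q.1 + q.2 • (w - x) := by module
  rw [e] at this
  simp only [smul_eq_mul] at this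
  linarith

/-- Truncating a lower semicontinuous extended-real function gives a lower semicontinuous real
function. -/
theorem lowerSemicontinuous_toReal_truncation {α : Type*} [TopologicalSpace α] {f : α → EReal}
    (hf : LowerSemicontinuous f) {m N : ℝ} (hmN : m ≤ N) :
    LowerSemicontinuous fun x => (max (m : EReal) (min (f x) N)).toReal := by
  have hfin : ∀ z : EReal, max (m : EReal) (min z N) ≠ ⊥ ∧ max (m : EReal) (min z N) ≠ ⊤ :=
    fun z => ⟨((EReal.bot_lt_coe m).trans_le (le_max_left _ _)).ne',
      ((max_le (EReal.coe_le_coe_iff.2 hmN) (min_le_right z _)).trans_lt (EReal.coe_lt_top N)).ne⟩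
  refine Continuous.comp_lowerSemicontinuous
    (g := fun z : EReal => (max (m : EReal) (min z N)).toReal) ?_ hf ?_
  · exact EReal.continuousOn_toReal.comp_continuous (by fun_prop) fun z => by simp [hfin z]
  · intro y z hyz
    exact EReal.toReal_le_toReal (max_le_max le_rfl (min_le_min hyz le_rfl)) (hfin y).1 (hfin z).2

/-- Exact penalization, up to `δ`, of the constraint of lying in a compact set. -/
theorem exists_le_add_mul_infDist {M : Type*} [MetricSpace M] {H : M → ℝ}
    (hH : LowerSemicontinuous H) {C D : Set M} (hC : IsClosed C) (hD : IsCompact D)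
    (hDne : D.Nonempty) {B a δ : ℝ} (hB : ∀ c ∈ C, B ≤ H c) (ha : ∀ p ∈ C ∩ D, a ≤ H p)
    (hδ : 0 < δ) :
    ∃ K : ℝ, 0 ≤ K ∧ ∀ c ∈ C, a - δ ≤ H c + K * Metric.infDist c D := by
  by_contra! hcon
  choose c hcC hc using fun n : ℕ => hcon n n.cast_nonneg
  choose p hpD hp using fun n : ℕ => hD.exists_infDist_eq_dist hDne (c n)
  have hdist : Tendsto (fun n => dist (c n) (p n)) atTop (𝓝 0) := by
    refine squeeze_zero' (g := fun n : ℕ => (a - δ - B) / (n : ℝ)) (.of_forall fun _ => dist_nonneg)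
      ?_ (tendsto_const_div_atTop_nhds_zero_nat _)
    filter_upwards [eventually_gt_atTop 0] with n hn
    have hn' : (0 : ℝ) < n := by exact_mod_cast hn
    rw [le_div_iff₀ hn', ← hp]
    linarith [hc n, hB _ (hcC n), mul_comm (n : ℝ) (Metric.infDist (c n) D)]
  obtain ⟨q, hq, ψ, hψ, hψq⟩ := hD.tendsto_subseq hpD
  have hcq : Tendsto (fun n => c (ψ n)) atTop (𝓝 q) := by
    have h := hdist.comp hψ.tendsto_atTop
    have h' := tendsto_iff_dist_tendsto_zero.1 hψq
    refine tendsto_iff_dist_tendsto_zero.2 (squeeze_zero (fun _ => dist_nonneg)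
      (fun n => dist_triangle _ (p (ψ n)) _) ?_)
    simpa using h.add h'
  have hqC : q ∈ C := hC.mem_of_tendsto hcq (.of_forall fun n => hcC _)
  have hlt : a - δ < H q := by linarith [ha q ⟨hqC, hq⟩]
  obtain ⟨n, hn⟩ := (hcq.eventually (hH q _ hlt)).exists
  have := hc (ψ n)
  have h0 : 0 ≤ (ψ n : ℝ) * Metric.infDist (c (ψ n)) D :=
    mul_nonneg (Nat.cast_nonneg _) Metric.infDist_nonneg
  linarith

section

variable {X : Type*} [NormedAddCommGroup X] [NormedSpace ℝ X]

theorem exists_forall_le_of_lt_radialSub {f : X → EReal} {x v : X} {c lam : ℝ}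
    (hfx : f x = c) (h : (lam : EReal) < radialSub f x v) :
    ∃ τ > 0, ∀ s ∈ Icc (0 : ℝ) τ, ((c + lam * s : ℝ) : EReal) ≤ f (x + s • v) := by
  have h' := eventually_lt_of_lt_liminf h
  obtain ⟨τ, hτ, hτ'⟩ := (mem_nhdsGT_iff_exists_Ioc_subset).1 h'
  refine ⟨τ, hτ, fun s hs => ?_⟩
  rcases hs.1.eq_or_lt with rfl | h0
  · simp [hfx]
  have hlt : (lam : EReal) < erSlope f x v s := hτ' ⟨h0, hs.2⟩
  rw [erSlope, hfx] at hlt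
  induction hz : f (x + s • v) with
  | bot =>
    rw [hz, EReal.bot_sub, EReal.bot_mul_coe_of_pos (inv_pos.2 h0)] at hlt
    exact absurd hlt not_lt_bot
  | top => exact le_top
  | coe z =>
    rw [hz, ← EReal.coe_sub, ← EReal.coe_mul, EReal.coe_lt_coe_iff, ← div_eq_mul_inv,
      lt_div_iff₀ h0] at hlt
    exact_mod_cast (by linarith : c + lam * s ≤ z)

theorem radialSub_smul_le {f : X → EReal} {x v : X} {a r : ℝ} (hr : 0 < r)
    (h : radialSub f x v < a) : radialSub f x (r • v) ≤ ((r * a : ℝ) : EReal) := by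
  have h1 : ∃ᶠ s in 𝓝[>] (0 : ℝ), erSlope f x v s < a :=
    frequently_lt_of_liminf_lt (by isBoundedDefault) h
  have ht : Tendsto (fun s : ℝ => s / r) (𝓝[>] 0) (𝓝[>] 0) := by
    refine tendsto_nhdsWithin_iff.2 ⟨?_, ?_⟩
    · have : Tendsto (fun s : ℝ => s / r) (𝓝 0) (𝓝 (0 / r)) := (continuous_id.div_const r).tendsto 0
      rw [zero_div] at this
      exact this.mono_left nhdsWithin_le_nhds
    · filter_upwards [self_mem_nhdsWithin] with s hs using div_pos hs hr
  refine liminf_le_of_frequently_le'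
    (ht.frequently ((h1.and_eventually self_mem_nhdsWithin).mono ?_))
  rintro s ⟨hs, hs0 : 0 < s⟩
  have e : erSlope f x (r • v) (s / r) = erSlope f x v s * r := by
    rw [erSlope, erSlope, smul_smul, div_mul_cancel₀ _ hr.ne', mul_assoc, ← EReal.coe_mul]
    congr 2
    field_simp
  rw [e, mul_comm r a, EReal.coe_mul]
  exact mul_le_mul_of_nonneg_right hs.le (by exact_mod_cast hr.le)

theorem ne_top_of_lt_radialSub {f : X → EReal} {x v : X} {a : EReal} (h : a < radialSub f x v) :
    f x ≠ ⊤ := by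
  intro hx
  refine h.not_ge (le_of_eq_of_le ?_ bot_le)
  have : ∀ᶠ s in 𝓝[>] (0 : ℝ), erSlope f x v s = ⊥ := by
    filter_upwards [self_mem_nhdsWithin] with s hs
    rw [erSlope, hx, EReal.sub_top, EReal.bot_mul_coe_of_pos (inv_pos.2 hs)]
  rw [radialSub, liminf_congr this, liminf_const]

end

section

variable {X : Type*} [NormedAddCommGroup X] [NormedSpace ℝ X]

/-- If `f` increases at rate at least `lam` from `x` in the direction `v`, then near `x` there is a
perturbed local minimum of `f` for a penalized linear tilt. -/
theorem exists_local_min_penalized [CompleteSpace X] {f : X → EReal} (hf : LowerSemicontinuous f)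
    {x v : X} (hv : v ≠ 0) {c r τ : ℝ} (hr : 0 < r) (hτ : 0 < τ) (hfx : f x = c)
    {g : X →L[ℝ] ℝ}
    (hg : ∀ s ∈ Icc (0 : ℝ) τ, ((c + g v * s : ℝ) : EReal) ≤ f (x + s • v)) {ε : ℝ} (hε : 0 < ε) :
    ∃ x' K, dist x' x ≤ ε ∧ 0 ≤ K ∧ f x' ≠ ⊤ ∧ ∀ᶠ y in 𝓝 x',
      f x' + ((K * Metric.infDist x' (segment ℝ x (x + r • v)) - g x' : ℝ) : EReal) ≤
      f y + ((K * Metric.infDist y (segment ℝ x (x + r • v)) - g y + ε * dist y x' : ℝ) :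
        EReal) := by
  set D := segment ℝ x (x + r • v) with hD
  have hvpos : 0 < ‖v‖ := norm_pos_iff.2 hv
  obtain ⟨ρ₀, hρ₀, hρ₀f⟩ := Metric.eventually_nhds_iff_ball.1
    (hf x ((c - 1 : ℝ) : EReal) (by
      show ((c - 1 : ℝ) : EReal) < f x
      rw [hfx, EReal.coe_lt_coe_iff]
      linarith))
  obtain ⟨ρ, hρ, hρlt⟩ := exists_between (lt_min hρ₀ (lt_min one_pos (mul_pos hτ hvpos)))
  simp only [lt_min_iff] at hρlt
  obtain ⟨hρρ₀, hρ1, hρτ⟩ := hρlt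
  set N := c + ‖g‖ + 1 with hN
  have hgn : 0 ≤ ‖g‖ := norm_nonneg g
  set F : X → ℝ := fun y => (max ((c - 1 : ℝ) : EReal) (min (f y) (N : EReal))).toReal with hF
  have hFlsc : LowerSemicontinuous F := lowerSemicontinuous_toReal_truncation hf (by linarith)
  have hFcoe : ∀ y, (F y : EReal) = max ((c - 1 : ℝ) : EReal) (min (f y) (N : EReal)) := fun y =>
    EReal.coe_toReal ((max_le (EReal.coe_le_coe_iff.2 (by linarith)) (min_le_right _ _)).trans_lt
      (EReal.coe_lt_top N)).ne ((EReal.bot_lt_coe _).trans_le (le_max_left _ _)).ne'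
  set C := Metric.closedBall x ρ with hC
  have hCf : ∀ y ∈ C, ((c - 1 : ℝ) : EReal) ≤ f y := fun y hy =>
    (hρ₀f y (Metric.closedBall_subset_ball hρρ₀ hy)).le
  have hFle : ∀ y ∈ C, (F y : EReal) ≤ f y := fun y hy => by
    rw [hFcoe]; exact max_le (hCf y hy) (min_le_left _ _)
  have hFge : ∀ y, c - 1 ≤ F y := fun y => by
    rw [← EReal.coe_le_coe_iff, hFcoe]; exact le_max_left _ _
  have hgC : ∀ y ∈ C, |g y - g x| ≤ ‖g‖ := fun y hy => by
    rw [← map_sub, ← Real.norm_eq_abs]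
    refine (g.le_opNorm _).trans (mul_le_of_le_one_right hgn ?_)
    rw [← dist_eq_norm]
    exact (Metric.mem_closedBall.1 hy).trans hρ1.le
  have hFx : F x ≤ c := by
    rw [← EReal.coe_le_coe_iff, ← hfx]; exact hFle x (Metric.mem_closedBall_self hρ.le)
  have hxD : x ∈ D := left_mem_segment ℝ _ _
  have hDc : IsCompact D := by
    rw [hD, segment_eq_image]
    exact isCompact_Icc.image (by fun_prop)
  have hHlsc : LowerSemicontinuous fun y => F y + (-g y) :=
    hFlsc.add (Continuous.lowerSemicontinuous (by fun_prop))
  have hCD : ∀ p ∈ C ∩ D, c - g x ≤ F p + (-g p) := by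
    rintro p ⟨hpC, hpD⟩
    obtain ⟨θ, hθ, rfl⟩ := (segment_eq_image' ℝ x (x + r • v)).subset hpD
    have e : x + θ • (x + r • v - x) = x + (θ * r) • v := by module
    simp only [e] at hpC ⊢
    have hs0 : 0 ≤ θ * r := mul_nonneg hθ.1 hr.le
    have hsn : (θ * r) * ‖v‖ ≤ ρ := by
      have := Metric.mem_closedBall.1 hpC
      rwa [dist_self_add_left, norm_smul, Real.norm_of_nonneg hs0] at this
    have hsτ : θ * r ≤ τ := by
      by_contra! hlt
      linarith [mul_lt_mul_of_pos_right hlt hvpos]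
    have hgp := hgC _ hpC
    have h1 := hg _ ⟨hs0, hsτ⟩
    have eg : g (x + (θ * r) • v) = g x + g v * (θ * r) := by
      rw [map_add, map_smul, smul_eq_mul, mul_comm]
    have h2 : c + g v * (θ * r) ≤ F (x + (θ * r) • v) := by
      rw [← EReal.coe_le_coe_iff, hFcoe]
      refine le_max_of_le_right (le_min h1 (EReal.coe_le_coe_iff.2 ?_))
      rw [eg] at hgp
      linarith [(abs_le.1 hgp).2]
    linarith
  obtain ⟨ε', hε', hε'lt⟩ := exists_between (lt_min hε hρ)
  simp only [lt_min_iff] at hε'lt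
  obtain ⟨K, hK, hKle⟩ := exists_le_add_mul_infDist hHlsc (C := C) Metric.isClosed_closedBall hDc
    ⟨x, hxD⟩ (B := c - 1 - g x - ‖g‖)
    (fun y hy => by linarith [hFge y, (abs_le.1 (hgC y hy)).2]) hCD (mul_pos hε' hε')
  have hclosed : IsClosed C := Metric.isClosed_closedBall
  have : CompleteSpace C := hclosed.completeSpace_coe
  have hGlsc : LowerSemicontinuous fun y : C => F y + (-g y) + K * Metric.infDist (y : X) D :=
    (hHlsc.add (Continuous.lowerSemicontinuous
      (continuous_const.mul (Metric.continuous_infDist_pt D)))).comp continuous_subtype_val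
  obtain ⟨⟨x', hx'C⟩, hx'1, hx'2⟩ := exists_ekeland_point hGlsc
    ⟨c - g x - ε' * ε', by rintro _ ⟨y, rfl⟩; exact hKle y y.2⟩
    ⟨x, Metric.mem_closedBall_self hρ.le⟩ hε'
  simp only [Subtype.dist_eq, Subtype.forall] at hx'1 hx'2
  rw [Metric.infDist_zero_of_mem hxD] at hx'1
  have hdist : dist x' x ≤ ε' := by
    have := hKle x' hx'C
    exact le_of_mul_le_mul_left (by linarith) hε'
  have hd0 : 0 ≤ K * Metric.infDist x' D := mul_nonneg hK Metric.infDist_nonneg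
  have hFx'N : F x' < N := by
    have := mul_nonneg hε'.le (dist_nonneg (x := x') (y := x))
    linarith [(abs_le.1 (hgC x' hx'C)).2]
  have hfx' : f x' = F x' := by
    have h1 : (F x' : EReal) < N := by exact_mod_cast hFx'N
    rw [hFcoe, max_lt_iff, min_lt_iff] at h1
    have h2 : f x' < N := h1.2.resolve_right (lt_irrefl _)
    rw [hFcoe, min_eq_left h2.le, max_eq_right (hCf x' hx'C)]
  refine ⟨x', K, hdist.trans hε'lt.1.le, hK, by rw [hfx']; exact EReal.coe_ne_top _, ?_⟩
  have hnhds : C ∈ 𝓝 x' := Metric.closedBall_mem_nhds_of_mem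
    (Metric.mem_ball.2 (hdist.trans_lt hε'lt.2))
  filter_upwards [hnhds] with y hy
  refine le_trans ?_ (add_le_add_left (hFle y hy) _)
  rw [hfx', ← EReal.coe_add, ← EReal.coe_add, EReal.coe_le_coe_iff]
  have h1 := hx'2 y hy
  have h2 := mul_le_mul_of_nonneg_right hε'lt.1.le (dist_nonneg (x := y) (y := x'))
  linarith

/-- Approximate mean value inequality: a lower bound on the radial subderivative at `x` in the
direction `v` is reflected by a subgradient at a nearby point `x'`, tested on
`x + r • v - x'`. -/
theorem exists_mem_sub_lt_apply_of_lt_radialSub [CompleteSpace X] (S : Subdifferential X)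
    {f : X → EReal} (hf : ProperLsc f) {x v : X} (hv : v ≠ 0) {r lam : ℝ} (hr : 0 < r)
    (h : (lam : EReal) < radialSub f x v) {μ : ℝ} (hμ : 0 < μ) :
    ∃ x', dist x' x < μ ∧ ∃ p ∈ S.sub f x', r * lam - μ < p (x + r • v - x') := by
  obtain ⟨c, hc⟩ : ∃ c : ℝ, f x = c :=
    ⟨(f x).toReal, (EReal.coe_toReal (ne_top_of_lt_radialSub h) (hf.2.2 x)).symm⟩
  obtain ⟨g, hgv⟩ : ∃ g : X →L[ℝ] ℝ, g v = lam := by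
    obtain ⟨g₀, -, hg₀⟩ := exists_dual_vector ℝ v (norm_ne_zero_iff.2 hv)
    refine ⟨(lam / ‖v‖) • g₀, ?_⟩
    simp only [smul_apply, hg₀, smul_eq_mul]
    exact div_mul_cancel₀ _ (norm_ne_zero_iff.2 hv)
  obtain ⟨τ, hτ, hτf⟩ := exists_forall_le_of_lt_radialSub hc h
  set w := x + r • v with hw
  obtain ⟨ε, hε, hεlt⟩ : ∃ ε > 0, ε < μ ∧ ε * (‖g‖ + ‖w - x‖ + ε) < μ := by
    have h1 : Tendsto (fun ε : ℝ => ε * (‖g‖ + ‖w - x‖ + ε)) (𝓝[>] 0) (𝓝 0) := by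
      have : Continuous fun ε : ℝ => ε * (‖g‖ + ‖w - x‖ + ε) := by fun_prop
      simpa using (this.tendsto 0).mono_left nhdsWithin_le_nhds
    obtain ⟨ε, h2, h3, h4⟩ := ((h1.eventually (gt_mem_nhds hμ)).and
      (Ioo_mem_nhdsGT hμ)).exists
    exact ⟨ε, h3, h4, h2⟩
  obtain ⟨x', K, hx'x, hK, hfx', hmin⟩ :=
    exists_local_min_penalized hf.1 hv hr hτ hc (g := g) (by rwa [hgv]) hε
  set D := segment ℝ x w with hD
  have hwD : w ∈ D := right_mem_segment ℝ x w
  set φ : X → ℝ := fun y => K * Metric.infDist y D - g y + ε * dist y x' with hφ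
  have hφconv : ConvexOn ℝ univ φ := by
    have h1 : ConvexOn ℝ univ fun y => K * Metric.infDist y D :=
      (convexOn_infDist_of_convex (convex_segment x w) ⟨x, left_mem_segment ℝ x w⟩).smul hK
    have h2 : ConcaveOn ℝ univ fun y => g y := g.toLinearMap.concaveOn convex_univ
    have h3 : ConvexOn ℝ univ fun y => ε * dist y x' := (convexOn_univ_dist x').smul hε.le
    exact (h1.sub h2).add h3
  have hφcont : Continuous φ := by
    have := Metric.continuous_infDist_pt D
    fun_prop
  have hφlip : ∀ y z, φ y ≤ φ z + (K + ‖g‖ + ε) * ‖y - z‖ := by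
    intro y z
    have h1 := mul_le_mul_of_nonneg_left
      (Metric.infDist_le_infDist_add_dist (s := D) (x := y) (y := z)) hK
    have h2 := (abs_le.1 ((Real.norm_eq_abs _).symm.trans_le (g.le_opNorm (y - z)))).1
    have h3 := mul_le_mul_of_nonneg_left (dist_triangle y z x') hε.le
    rw [map_sub] at h2
    rw [dist_eq_norm y z] at h1 h3
    simp only [hφ]
    linarith
  have hφproper : ProperLsc fun y => (φ y : EReal) :=
    ⟨(continuous_coe_real_ereal.comp hφcont).lowerSemicontinuous, ⟨0, EReal.coe_ne_top _⟩,
      fun _ => EReal.coe_ne_bot _⟩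
  obtain ⟨p₁, ⟨l, hl, hlS, hlx, -, hlw, hlim⟩, p₂, hp₂, hp⟩ :=
    S.separation f (fun y => (φ y : EReal)) x' hf hφproper
      (fun y z a b ha hb hab => by
        have := hφconv.2 (mem_univ y) (mem_univ z) ha hb hab
        simp only [smul_eq_mul] at this
        simp only [← EReal.coe_mul, ← EReal.coe_add, EReal.coe_le_coe_iff]
        exact this)
      ⟨K + ‖g‖ + ε, 1, one_pos, fun _ _ => ⟨EReal.coe_ne_top _, EReal.coe_ne_bot _⟩,
        fun y _ z _ => by
          simp only [← EReal.coe_add, EReal.coe_le_coe_iff]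
          exact hφlip y z⟩
      hfx' (by simpa [hφ] using hmin)
  have hp₂w := apply_sub_le_of_mem_clarkeSubdiff hφconv hφcont
    (S.subset_clarke _ hφproper x' hp₂) w
  have hp₁w : r * lam - ε * (‖g‖ + ‖w - x‖ + ε) ≤ p₁ (w - x') := by
    have e1 : p₁ (w - x') = -p₂ (w - x') := by
      rw [eq_neg_of_add_eq_zero_left hp]; rfl
    have e2 : g w = g x + r * lam := by rw [hw, map_add, map_smul, hgv, smul_eq_mul]
    have h1 := (abs_le.1 ((Real.norm_eq_abs _).symm.trans_le (g.le_opNorm (x' - x)))).2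
    rw [map_sub] at h1
    have h2 : ‖g‖ * ‖x' - x‖ ≤ ‖g‖ * ε := by
      rw [← dist_eq_norm]; exact mul_le_mul_of_nonneg_left hx'x (norm_nonneg _)
    have h3 : dist w x' ≤ ‖w - x‖ + ε := by
      rw [← dist_eq_norm]
      exact (dist_triangle w x x').trans (by rw [dist_comm x x']; linarith)
    have h4 := mul_le_mul_of_nonneg_left h3 hε.le
    have h5 : 0 ≤ K * Metric.infDist x' D := mul_nonneg hK Metric.infDist_nonneg
    simp only [hφ, Metric.infDist_zero_of_mem hwD, dist_self] at hp₂w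
    linarith
  set η := (μ - ε * (‖g‖ + ‖w - x‖ + ε)) / 2 with hη
  have hηpos : 0 < η := by rw [hη]; linarith
  have hev1 : ∀ᶠ q in l, ((q.2 (q.1 - x') : ℝ) : EReal) < (η : EReal) :=
    eventually_lt_of_limsup_lt (hlim.trans_lt (by exact_mod_cast hηpos))
  have hev2 : ∀ᶠ q in l, p₁ (w - x') - η < q.2 (w - x') :=
    (hlw (w - x')).eventually (lt_mem_nhds (by linarith))
  have hev3 : ∀ᶠ q in l, dist q.1 x' < μ - ε :=
    hlx.eventually (Metric.ball_mem_nhds x' (by linarith))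
  obtain ⟨q, hq1, hq2, hq3, hqS⟩ := (hev1.and (hev2.and (hev3.and hlS))).exists
  refine ⟨q.1, ?_, q.2, hqS, ?_⟩
  · linarith [dist_triangle q.1 x' x]
  · have e : q.2 (w - q.1) = q.2 (w - x') - q.2 (q.1 - x') := by
      rw [← map_sub]; congr 1; abel
    have hq1' : q.2 (q.1 - x') < η := by exact_mod_cast hq1
    linarith

theorem coe_mul_le_of_forall_limsup_le [CompleteSpace X] (S : Subdifferential X)
    {f : X → EReal} (hf : ProperLsc f) {x₀ w : X} {A : EReal} {r lam : ℝ} (hr : 0 < r)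
    {xs vs : ℕ → X} (hxs : Tendsto xs atTop (𝓝 x₀)) (hvs : ∀ n, vs n ≠ 0)
    (hw : ∀ n, xs n + r • vs n = w) (hlam : ∀ n, (lam : EReal) < radialSub f (xs n) (vs n))
    (hA : ∀ (ys : ℕ → X) (ps : ℕ → X →L[ℝ] ℝ), (∀ n, ps n ∈ S.sub f (ys n)) →
      Tendsto ys atTop (𝓝 x₀) → limsup (fun n => ((ps n (w - ys n) : ℝ) : EReal)) atTop ≤ A) :
    ((r * lam : ℝ) : EReal) ≤ A := by
  choose ys hys ps hps hlt using fun n : ℕ =>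
    exists_mem_sub_lt_apply_of_lt_radialSub S hf (hvs n) hr (hlam n)
      (Nat.one_div_pos_of_nat (α := ℝ) (n := n))
  have hlim : Tendsto ys atTop (𝓝 x₀) := by
    refine tendsto_of_tendsto_of_dist hxs ?_
    refine squeeze_zero (fun _ => dist_nonneg) (fun n => ?_) tendsto_one_div_add_atTop_nhds_zero_nat
    rw [dist_comm]
    exact (hys n).le
  refine le_trans ?_ (hA ys ps hps hlim)
  have hlim' : Tendsto (fun n : ℕ => ((r * lam - 1 / ((n : ℝ) + 1) : ℝ) : EReal)) atTop
      (𝓝 ((r * lam : ℝ) : EReal)) := by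
    have h := (tendsto_const_nhds (x := r * lam)).sub
      (tendsto_one_div_add_atTop_nhds_zero_nat (𝕜 := ℝ))
    rw [sub_zero] at h
    exact (continuous_coe_real_ereal.tendsto _).comp h
  rw [← hlim'.limsup_eq]
  refine limsup_le_limsup (.of_forall fun n => ?_)
  have h := (hlt n).le
  rw [hw n] at h
  exact EReal.coe_le_coe_iff.2 h

/-- A continuous real function on an interval cannot have lower right Dini derivative `-∞`
at every point. -/
theorem not_forall_frequently_slope_lt {γ : ℝ → ℝ} {a b : ℝ} (hab : a < b)
    (hγ : ContinuousOn γ (Icc a b)) :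
    ¬ ∀ s ∈ Ico a b, ∀ q : ℝ, ∃ᶠ z in 𝓝[>] s, slope γ s z < q := by
  intro h
  set M : ℝ := (γ a - γ b + 1) / (b - a) with hM
  have hle := image_le_of_liminf_slope_right_le_deriv_boundary hγ
    (B := fun s => γ a - M * (s - a)) (B' := fun _ => -M) (by simp) (by fun_prop)
    (fun s _ => by
      simpa using (((hasDerivAt_id s).sub_const a).const_mul M).const_sub (γ a)
        |>.hasDerivWithinAt (s := Ici s))
    (fun s hs q _ => h s hs q) (right_mem_Icc.2 hab.le)
  have : M * (b - a) = γ a - γ b + 1 := div_mul_cancel₀ _ (sub_pos.2 hab).ne'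
  linarith

/-- A function which is finite and continuous along a segment cannot have radial subderivative
`-∞` at all its points. -/
theorem exists_radialSub_ne_bot {f : X → EReal} {x u : X} {a b : ℝ} (hab : a < b)
    (hfin : ∀ s ∈ Icc a b, f (x + s • u) ≠ ⊤ ∧ f (x + s • u) ≠ ⊥)
    (hcont : ContinuousOn (fun s : ℝ => f (x + s • u)) (Icc a b)) :
    ∃ s ∈ Ico a b, radialSub f (x + s • u) u ≠ ⊥ := by
  by_contra! h
  have hγ : ContinuousOn (fun s : ℝ => (f (x + s • u)).toReal) (Icc a b) :=
    EReal.continuousOn_toReal.comp hcont fun s hs => by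
      simpa using (hfin s hs).symm
  refine not_forall_frequently_slope_lt hab hγ fun s hs q => ?_
  have h1 : radialSub f (x + s • u) u < (q : EReal) := by rw [h s hs]; exact EReal.bot_lt_coe q
  have h2 : ∃ᶠ z in 𝓝[>] (0 : ℝ), erSlope f (x + s • u) u z < q :=
    frequently_lt_of_liminf_lt (by isBoundedDefault) h1
  have ht : Tendsto (fun z : ℝ => s + z) (𝓝[>] 0) (𝓝[>] s) := by
    refine tendsto_nhdsWithin_iff.2 ⟨?_, ?_⟩
    · have : Tendsto (fun z : ℝ => s + z) (𝓝 0) (𝓝 (s + 0)) :=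
        (continuous_const.add continuous_id).tendsto 0
      rw [add_zero] at this
      exact this.mono_left nhdsWithin_le_nhds
    · filter_upwards [self_mem_nhdsWithin] with z hz using by simpa using hz
  refine ht.frequently ((h2.and_eventually (Ioo_mem_nhdsGT (sub_pos.2 hs.2))).mono ?_)
  rintro z ⟨hz, hz0, hz1⟩
  have e : x + s • u + z • u = x + (s + z) • u := by module
  have hs' := hfin s (Ico_subset_Icc_self hs)
  have hz' := hfin (s + z) ⟨by linarith [hs.1], by linarith⟩
  rw [erSlope, e, ← EReal.coe_toReal hs'.1 hs'.2, ← EReal.coe_toReal hz'.1 hz'.2,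
    ← EReal.coe_sub, ← EReal.coe_mul, EReal.coe_lt_coe_iff, ← div_eq_mul_inv] at hz
  rwa [slope_def_field, add_sub_cancel_left]

theorem exists_lt_radialSub_of_lt_iInf_ptLimsup {f : X → EReal} {x u : X} {q : EReal}
    (h : q < ⨅ α ∈ Ici (0 : ℝ), ptLimsup (fun y => radialSub f y (u + α • (x - y))) x)
    {α δ : ℝ} (hα : 0 ≤ α) (hδ : 0 < δ) :
    ∃ y, ‖y - x‖ < δ ∧ q < radialSub f y (u + α • (x - y)) := by
  have h1 := h.trans_le ((iInf₂_le α hα).trans (iInf₂_le δ hδ))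
  obtain ⟨y, hy⟩ := lt_iSup_iff.1 h1
  obtain ⟨hyδ, hy⟩ := lt_iSup_iff.1 hy
  exact ⟨y, hyδ.2, hy⟩

end

/-- **sds implies strictly upper semismooth.** -/
theorem sds_strict_upper_semismooth
    {X : Type*} [NormedAddCommGroup X] [NormedSpace ℝ X] [CompleteSpace X]
    (D : Subdifferential X) (Ω : Set X) (hΩo : IsOpen Ω) (hΩc : Convex ℝ Ω)
    (hΩne : Ω.Nonempty)
    (f : X → EReal) (hf : ProperLsc f) (hdom : ∃ x ∈ Ω, f x ≠ ⊤)
    (hsds : SDS (D.sub f) f Ω)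
    (xbar : X) (hxbarΩ : xbar ∈ Ω) (hxbard : (D.sub f xbar).Nonempty)
    (u : X) (hu : u ≠ 0) (hxuΩ : xbar + u ∈ Ω) (hxuf : f (xbar + u) ≠ ⊤)
    (t : ℝ) (ht : t ∈ Set.Ico (0:ℝ) 1) :
    StrictUpperSemismooth f (xbar + t • u) u ∧
      radialSub f (xbar + t • u) u ≠ ⊤ ∧ radialSub f (xbar + t • u) u ≠ ⊥ := by
  have hun : 0 < ‖u‖ := norm_pos_iff.2 hu
  obtain ⟨hfin, hcont, hderiv, hstab⟩ := hsds xbar hxbarΩ hxbard (xbar + u) hxuΩ hxuf (by simpa)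
  simp only [add_sub_cancel_left] at hfin hcont hderiv hstab
  set y := xbar + t • u with hy
  refine ⟨?_, ?_, ?_⟩
  · change _ ≤ radialSub f y u
    by_contra! hlt
    obtain ⟨q₁, hq₁, hq₁'⟩ := EReal.lt_iff_exists_real_btwn.1 hlt
    obtain ⟨q, hq, hq'⟩ := EReal.lt_iff_exists_real_btwn.1 hq₁'
    rw [EReal.coe_lt_coe_iff] at hq
    obtain ⟨r, ⟨hr, hr1⟩, hstab⟩ := hstab t ht ((q - q₁) / (2 * ‖u‖))
      (div_pos (sub_pos.2 hq) (by positivity))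
    choose xs hxs hxslt using fun n : ℕ => exists_lt_radialSub_of_lt_iInf_ptLimsup hq'
      (inv_nonneg.2 hr.le)
      (lt_min (Nat.one_div_pos_of_nat (α := ℝ) (n := n)) (mul_pos hr hun))
    have hxslim : Tendsto xs atTop (𝓝 y) := by
      rw [tendsto_iff_norm_sub_tendsto_zero]
      exact squeeze_zero (fun _ => norm_nonneg _) (fun n => (lt_min_iff.1 (hxs n)).1.le)
        tendsto_one_div_add_atTop_nhds_zero_nat
    have hw : ∀ n, xs n + r • (u + r⁻¹ • (y - xs n)) = y + r • u := fun n => by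
      rw [smul_add, smul_inv_smul₀ hr.ne']
      abel
    have hvs : ∀ n, u + r⁻¹ • (y - xs n) ≠ 0 := fun n h0 => by
      have h1 := hw n
      rw [h0, smul_zero, add_zero] at h1
      have h2 := (lt_min_iff.1 (hxs n)).2
      rw [h1, add_sub_cancel_left, norm_smul, Real.norm_of_nonneg hr.le] at h2
      exact lt_irrefl _ h2
    have hle := coe_mul_le_of_forall_limsup_le D hf hr hxslim hvs hw hxslt
      (hstab r ⟨hr, le_rfl⟩ 0 ⟨le_rfl, one_pos⟩ y (y + r • u) y hy rfl (by simp))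
    rw [add_sub_cancel_left, norm_smul, Real.norm_of_nonneg hr.le] at hle
    have hle' := hle.trans (add_le_add_left (radialSub_smul_le hr hq₁) _)
    rw [← EReal.coe_add, EReal.coe_le_coe_iff] at hle'
    have e : (q - q₁) / (2 * ‖u‖) * (r * ‖u‖) = r * ((q - q₁) / 2) := by field_simp
    rw [e, ← mul_add] at hle'
    linarith [le_of_mul_le_mul_left hle' hr]
  · obtain ⟨d, hd, hlim⟩ := hderiv t ht
    have e : erSlope f y u = fun s : ℝ =>
        (f (xbar + (t + s) • u) - f (xbar + t • u)) * ((s⁻¹ : ℝ) : EReal) := by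
      funext s
      rw [erSlope, hy, add_assoc, ← add_smul]
    rw [radialSub, e, hlim.liminf_eq]
    exact hd.ne
  · intro hbot
    obtain ⟨r, ⟨hr, hr1⟩, hstab⟩ := hstab t ht 1 one_pos
    obtain ⟨b, htb, hb⟩ := exists_between (lt_min ht.2 (lt_add_of_pos_right t hr))
    rw [lt_min_iff] at hb
    have hsub : Icc t b ⊆ Icc 0 1 := Icc_subset_Icc ht.1 hb.1.le
    obtain ⟨s, hs, hsbot⟩ := exists_radialSub_ne_bot htb (fun s hs => hfin s (hsub hs))
      (hcont.mono hsub)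
    obtain ⟨lam, -, hlam⟩ := EReal.lt_iff_exists_real_btwn.1 (bot_lt_iff_ne_bot.2 hsbot)
    have hρ : 0 < r - (s - t) := by linarith [hs.2]
    have hw : xbar + s • u + (r - (s - t)) • u = y + r • u := by rw [hy]; module
    have hle := coe_mul_le_of_forall_limsup_le D hf hρ
      (tendsto_const_nhds (x := xbar + s • u)) (fun _ => hu) (fun _ => hw) (fun _ => hlam)
      (hstab r ⟨hr, le_rfl⟩ ((s - t) / r)
        ⟨div_nonneg (sub_nonneg.2 hs.1) hr.le, (div_lt_one hr).2 (by linarith)⟩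
        y (y + r • u) (xbar + s • u) hy rfl
        (by rw [div_mul_cancel₀ _ hr.ne', hy]; module))
    rw [← hw, add_sub_cancel_left, one_mul] at hle
    set B := ‖(r - (s - t)) • u‖
    have hle' := hle.trans (add_le_add_left (radialSub_smul_le (a := lam - (B + 1) / (r - (s - t)))
      hρ (hbot ▸ EReal.bot_lt_coe _)) _)
    rw [← EReal.coe_add, EReal.coe_le_coe_iff, mul_sub, mul_div_cancel₀ _ hρ.ne'] at hle'
    linarith
end

section
/- (Recovering the radial subderivative, directional version) Let X be a real Banach space, let ∂ be a subdifferential (an operator satisfying ∂_MR f ⊆ ∂f ⊆ ∂_C f and the Separation Principle), let f : X → (−∞,+∞] be proper lower semicontinuous, x̄ ∈ dom f and u ∈ X with u ≠ 0. If f is radially accessible at x̄ from u, then f is upper semismooth at x̄ in the direction u if and only if f^r(x̄;u) = inf_{α≥0} limsup_{x→_u x̄} f^∂(x; u + α(x̄ − x)). -/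
open Filter Topology Set

/-- Ekeland's variational principle for a real-valued lower semicontinuous function. -/
theorem ekeland {Y : Type*} [MetricSpace Y] [CompleteSpace Y] {h : Y → ℝ}
    (hl : LowerSemicontinuous h) (hb : BddBelow (Set.range h)) (y₀ : Y) {η : ℝ} (hη : 0 < η) :
    ∃ v, h v + η * dist v y₀ ≤ h y₀ ∧ ∀ z, h v ≤ h z + η * dist z v := by
  set S : Y → Set Y := fun z => {w | h w + η * dist w z ≤ h z} with hS
  have hself : ∀ z, z ∈ S z := fun z => by simp [hS]
  have hclosed : ∀ z, IsClosed (S z) := fun z => by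
    have : LowerSemicontinuous fun w => h w + η * dist w z :=
      hl.add (by fun_prop : Continuous fun w => η * dist w z).lowerSemicontinuous
    exact lowerSemicontinuous_iff_isClosed_preimage.1 this (h z)
  have htrans : ∀ {x y z}, z ∈ S y → y ∈ S x → z ∈ S x := by
    intro x y z hz hy
    simp only [hS, Set.mem_ofPred_eq] at hz hy ⊢
    nlinarith [dist_triangle z y x]
  have hnext : ∀ z, ∃ w ∈ S z, ∀ y ∈ S z, 2 * h w ≤ h z + h y := by
    intro z
    have hbz : BddBelow (h '' S z) := hb.mono (Set.image_subset_range _ _)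
    have hI : ∀ y ∈ S z, sInf (h '' S z) ≤ h y := fun y hy => csInf_le hbz ⟨y, hy, rfl⟩
    rcases (hI z (hself z)).lt_or_eq with hlt | heq
    · obtain ⟨_, ⟨w, hw, rfl⟩, hw'⟩ := exists_lt_of_csInf_lt (Set.Nonempty.image h ⟨z, hself z⟩)
        (show sInf (h '' S z) < (h z + sInf (h '' S z)) / 2 by linarith)
      exact ⟨w, hw, fun y hy => by linarith [hI y hy]⟩
    · exact ⟨z, hself z, fun y hy => by linarith [hI y hy]⟩
  choose g hgS hg using hnext
  set x : ℕ → Y := fun n => g^[n] y₀ with hx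
  have hxs : ∀ n, x (n + 1) = g (x n) := fun n => by simp [hx, Function.iterate_succ_apply']
  have hmem : ∀ n m, n ≤ m → x m ∈ S (x n) := by
    intro n m hnm
    induction m, hnm using Nat.le_induction with
    | base => exact hself _
    | succ m _ ih => exact htrans (hxs m ▸ hgS (x m)) ih
  have hanti : Antitone fun n => h (x n) := by
    intro n m hnm
    have := hmem n m hnm
    simp only [hS, Set.mem_ofPred_eq] at this
    nlinarith [dist_nonneg (x := x m) (y := x n)]
  obtain ⟨L, hL⟩ : ∃ L, Tendsto (fun n => h (x n)) atTop (𝓝 L) :=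
    ⟨_, tendsto_atTop_ciInf hanti (hb.mono (by rintro _ ⟨n, rfl⟩; exact ⟨_, rfl⟩))⟩
  have hLle : ∀ n, L ≤ h (x n) := fun n => hanti.le_of_tendsto hL n
  have hcauchy : CauchySeq x := by
    refine cauchySeq_of_le_tendsto_0' (fun n => (h (x n) - L) / η) (fun n m hnm => ?_) ?_
    · have := hmem n m hnm
      simp only [hS, Set.mem_ofPred_eq] at this
      rw [le_div_iff₀ hη, dist_comm]
      linarith [hLle m]
    · simpa using (hL.sub_const L).div_const η
  obtain ⟨v, hv⟩ := cauchySeq_tendsto_of_complete hcauchy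
  have hvS : ∀ n, v ∈ S (x n) := fun n =>
    (hclosed (x n)).mem_of_tendsto hv (eventually_atTop.2 ⟨n, fun m hm => hmem n m hm⟩)
  refine ⟨v, hvS 0, fun z => ?_⟩
  by_cases hz : z ∈ S v
  · have h1 : 2 * L ≤ L + h z := by
      refine le_of_tendsto_of_tendsto' ((hL.comp (tendsto_add_atTop_nat 1)).const_mul 2)
        (hL.add_const (h z)) fun n => ?_
      simpa [hxs] using hg (x n) z (htrans hz (hvS n))
    have h2 : h v ≤ L := ge_of_tendsto' hL fun n => by
      have := hvS n
      simp only [hS, Set.mem_ofPred_eq] at this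
      nlinarith [dist_nonneg (x := v) (y := x n)]
    nlinarith [dist_nonneg (x := z) (y := v)]
  · simp only [hS, Set.mem_ofPred_eq, not_le] at hz
    exact hz.le

theorem IsCompact.convexOn_infDist {X : Type*} [NormedAddCommGroup X] [NormedSpace ℝ X]
    {S : Set X} (hS : IsCompact S) (hne : S.Nonempty) (hc : Convex ℝ S) :
    ConvexOn ℝ Set.univ (fun z => Metric.infDist z S) := by
  refine ⟨convex_univ, fun x _ y _ a b ha hb hab => ?_⟩
  obtain ⟨p, hp, hpx⟩ := hS.exists_infDist_eq_dist hne x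
  obtain ⟨q, hq, hqy⟩ := hS.exists_infDist_eq_dist hne y
  refine (Metric.infDist_le_dist_of_mem (hc hp hq ha hb hab)).trans ?_
  simp only [hpx, hqy, dist_eq_norm, smul_eq_mul]
  calc ‖a • x + b • y - (a • p + b • q)‖ = ‖a • (x - p) + b • (y - q)‖ := by congr 1; module
    _ ≤ ‖a • (x - p)‖ + ‖b • (y - q)‖ := norm_add_le _ _
    _ = _ := by rw [norm_smul, norm_smul, Real.norm_of_nonneg ha, Real.norm_of_nonneg hb]

theorem slope_lt_iff {m c t : ℝ} (ht : 0 < t) (a : EReal) :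
    (a - m) * ((t⁻¹ : ℝ) : EReal) < c ↔ a < ((m + c * t : ℝ) : EReal) := by
  induction a with
  | bot => simpa [EReal.bot_mul_coe_of_pos (inv_pos.2 ht)] using EReal.bot_lt_coe (m + c * t)
  | top => simp [EReal.top_mul_coe_of_pos (inv_pos.2 ht)]
  | coe a =>
    norm_cast
    rw [← div_eq_mul_inv, div_lt_iff₀ ht, sub_lt_iff_lt_add']

theorem lt_slope_iff {m c t : ℝ} (ht : 0 < t) (a : EReal) :
    (c : EReal) < (a - m) * ((t⁻¹ : ℝ) : EReal) ↔ ((m + c * t : ℝ) : EReal) < a := by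
  induction a with
  | bot => simp [EReal.bot_mul_coe_of_pos (inv_pos.2 ht)]
  | top => simpa [EReal.top_mul_coe_of_pos (inv_pos.2 ht)] using EReal.coe_lt_top (m + c * t)
  | coe a =>
    norm_cast
    rw [← div_eq_mul_inv, lt_div_iff₀ ht, lt_sub_iff_add_lt']

theorem slope_top {t : ℝ} (ht : 0 < t) (a : EReal) :
    (a - ⊤) * ((t⁻¹ : ℝ) : EReal) = ⊥ := by
  simp [EReal.bot_mul_coe_of_pos (inv_pos.2 ht)]

/-- A lower semicontinuous function of one variable whose lower right Dini derivative is at most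
`c` grows at rate at most `c`. -/
theorem le_add_mul_of_frequently {g : ℝ → EReal} (hg : LowerSemicontinuous g) {m c t : ℝ}
    (ht : 0 ≤ t) (h0 : g 0 ≤ m)
    (h : ∀ s ∈ Set.Ico 0 t, ∀ r : ℝ, g s ≤ r →
      ∃ s' ∈ Set.Ioc s t, g s' ≤ ((r + c * (s' - s) : ℝ) : EReal)) :
    g t ≤ ((m + c * t : ℝ) : EReal) := by
  have hclosed : IsClosed ({s | g s ≤ ((m + c * s : ℝ) : EReal)} ∩ Set.Icc 0 t) := by
    refine IsClosed.inter ?_ isClosed_Icc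
    have hepi := hg.isClosed_epigraph
    exact hepi.preimage (f := fun s : ℝ => (s, ((m + c * s : ℝ) : EReal)))
      (continuous_id.prodMk (continuous_coe_real_ereal.comp (by fun_prop)))
  refine hclosed.mem_of_ge_of_forall_exists_gt (by simpa using h0) ht ?_
  rintro s ⟨hs, hst⟩
  obtain ⟨s', hs', hgs⟩ := h s hst _ hs
  refine ⟨s', hgs.trans_eq ?_, hs'⟩
  congr 1; ring

theorem crSub_le_of_forall_radialSub_le {X : Type*} [NormedAddCommGroup X] [NormedSpace ℝ X]
    {f : X → EReal} (hf : ProperLsc f) {xbar u x : X} {α : ℝ} {U : Set X}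
    (hU : U ∈ 𝓝 x) {M : EReal} (hM : ∀ z ∈ U, radialSub f z (u + α • (xbar - z)) ≤ M) :
    crSub f x (u + α • (xbar - x)) ≤ M := by
  refine EReal.le_of_forall_lt_iff_le.1 fun c hc => ?_
  obtain ⟨c₀, hMc, hcc⟩ := EReal.lt_iff_exists_real_btwn.1 hc
  rw [EReal.coe_lt_coe_iff] at hcc
  refine iSup₂_le fun δ hδ => limsup_le_of_le (h := ?_)
  have hw : Continuous fun z : X => u + α • (xbar - z) := by fun_prop
  have e1 : ∀ᶠ y in 𝓝 x, u + α • (xbar - y) ∈ Metric.ball (u + α • (xbar - x)) δ :=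
    hw.continuousAt (Metric.ball_mem_nhds _ hδ)
  have e2 : ∀ᶠ p in 𝓝 x ×ˢ 𝓝 (0:ℝ), p.1 + p.2 • (u + α • (xbar - p.1)) ∈ U := by
    rw [← nhds_prod_eq]
    refine Continuous.continuousAt (f := fun p : X × ℝ => p.1 + p.2 • (u + α • (xbar - p.1)))
      (by fun_prop) ?_
    simpa using hU
  obtain ⟨P, hP, Q, hQ, hPQ⟩ := Filter.eventually_prod_iff.1 e2
  have hQ' : ∀ᶠ t in 𝓝[>] (0:ℝ), ∀ s ∈ Set.Icc 0 t, Q s ∧ 0 < 1 - α * s ∧ c₀ ≤ c * (1 - α * s) := by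
    have h1 : ∀ᶠ s in 𝓝 (0:ℝ), 0 < 1 - α * s :=
      (by fun_prop : Continuous fun s : ℝ => 1 - α * s).continuousAt.eventually_const_lt (by simp)
    have h2 : ∀ᶠ s in 𝓝 (0:ℝ), c₀ < c * (1 - α * s) :=
      (by fun_prop : Continuous fun s : ℝ => c * (1 - α * s)).continuousAt.eventually_const_lt
        (by simpa using hcc)
    obtain ⟨r, hr, hball⟩ := Metric.eventually_nhds_iff.1 (hQ.and (h1.and h2))
    filter_upwards [Ioo_mem_nhdsGT hr] with t ht s hs
    have := @hball s (by rw [Real.dist_0_eq_abs, abs_of_nonneg hs.1]; exact hs.2.trans_lt ht.2)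
    exact ⟨this.1, this.2.1, this.2.2.le⟩
  have ev : ∀ᶠ p in (𝓝 x ⊓ comap f (𝓝 (f x))) ×ˢ 𝓝[>] (0:ℝ),
      (u + α • (xbar - p.1) ∈ Metric.ball (u + α • (xbar - x)) δ ∧ P p.1) ∧
      (p.2 ∈ Set.Ioi (0:ℝ) ∧
        ∀ s ∈ Set.Icc 0 p.2, Q s ∧ 0 < 1 - α * s ∧ c₀ ≤ c * (1 - α * s)) :=
    ((e1.and hP).filter_mono inf_le_left).prod_mk (eventually_mem_nhdsWithin.and hQ')
  filter_upwards [ev] with p hp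
  obtain ⟨y, t⟩ := p
  obtain ⟨⟨hy, hPy⟩, ht, hs⟩ := hp
  simp only [Set.mem_Ioi] at hy hPy ht hs ⊢
  refine (iInf₂_le _ hy).trans ?_
  rcases eq_or_ne (f y) ⊤ with htop | hntop
  · rw [htop, slope_top ht]; exact bot_le
  obtain ⟨m, hm⟩ : ∃ m : ℝ, f y = m := ⟨_, (EReal.coe_toReal hntop (hf.2.2 y)).symm⟩
  rw [hm]
  rw [← not_lt, lt_slope_iff ht, not_lt]
  set w := u + α • (xbar - y) with hw'
  refine le_add_mul_of_frequently (g := fun s => f (y + s • w))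
    (LowerSemicontinuous.comp hf.1 (by fun_prop)) ht.le
    (by simp [hm]) fun s hst r hr => ?_
  obtain ⟨hQs, hpos, hcs⟩ := hs s ⟨hst.1, hst.2.le⟩
  have hz := (hM _ (hPQ hPy hQs)).trans_lt hMc
  have hdir : u + α • (xbar - (y + s • w)) = (1 - α * s) • w := by rw [hw']; module
  simp only [← hw'] at hz
  rw [hdir] at hz
  have hfr := frequently_lt_of_liminf_lt (h := hz)
  have hsmall : ∀ᶠ τ in 𝓝[>] (0:ℝ), 0 < τ ∧ τ * (1 - α * s) < t - s := by
    refine eventually_mem_nhdsWithin.and <| Filter.Eventually.filter_mono nhdsWithin_le_nhds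
      <| (by fun_prop : Continuous fun τ : ℝ => τ * (1 - α * s)).continuousAt.eventually_lt_const
      (by simpa using hst.2)
  obtain ⟨τ, hτ, hτ0, hτt⟩ := (hfr.and_eventually hsmall).exists
  have hzt : f (y + s • w) ≠ ⊤ := ne_top_of_le_ne_top (EReal.coe_ne_top r) hr
  obtain ⟨k, hk⟩ : ∃ k : ℝ, f (y + s • w) = k := ⟨_, (EReal.coe_toReal hzt (hf.2.2 _)).symm⟩
  simp only [erSlope] at hτ
  rw [hk, slope_lt_iff hτ0] at hτ
  have hkr : k ≤ r := by simpa [hk] using hr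
  refine ⟨s + τ * (1 - α * s), ⟨by nlinarith [mul_pos hτ0 hpos], by linarith⟩, ?_⟩
  have hpt : y + s • w + τ • ((1 - α * s) • w) = y + (s + τ * (1 - α * s)) • w := by module
  rw [hpt] at hτ
  refine hτ.le.trans (EReal.coe_le_coe_iff.2 ?_)
  nlinarith

theorem supportSub_le_of_forall_radialSub_le {X : Type*} [NormedAddCommGroup X] [NormedSpace ℝ X]
    (D : Subdifferential X) {f : X → EReal} (hf : ProperLsc f) {xbar u x : X} {α : ℝ}
    {U : Set X} (hU : U ∈ 𝓝 x) {M : EReal}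
    (hM : ∀ z ∈ U, radialSub f z (u + α • (xbar - z)) ≤ M) :
    supportSub (D.sub f) x (u + α • (xbar - x)) ≤ M :=
  iSup₂_le fun _ hp =>
    (D.subset_clarke f hf x hp _).trans (crSub_le_of_forall_radialSub_le hf hU hM)

/-- A Clarke subgradient of a continuous convex function is a subgradient of convex analysis. -/
theorem le_sub_of_mem_clarkeSubdiff {X : Type*} [NormedAddCommGroup X] [NormedSpace ℝ X]
    {φ : X → ℝ} (hφ : Continuous φ) (hc : ConvexOn ℝ Set.univ φ) {v : X} {p : X →L[ℝ] ℝ}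
    (hp : p ∈ clarkeSubdiff (fun z => (φ z : EReal)) v) (w : X) : p w ≤ φ (v + w) - φ v := by
  rw [← EReal.coe_le_coe_iff]
  refine (hp w).trans (EReal.le_of_forall_lt_iff_le.1 fun c hc' => ?_)
  refine iSup₂_le fun δ hδ => limsup_le_of_le (h := ?_)
  have e1 : ∀ᶠ y in 𝓝 v, φ (y + w) - φ y < c :=
    (by fun_prop : Continuous fun y => φ (y + w) - φ y).continuousAt.eventually_lt_const
      (EReal.coe_lt_coe_iff.1 hc')
  have ev : ∀ᶠ q in (𝓝 v ⊓ comap (fun z => (φ z : EReal)) (𝓝 (φ v : EReal))) ×ˢ 𝓝[>] (0:ℝ),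
      φ (q.1 + w) - φ q.1 < c ∧ q.2 ∈ Set.Ioo (0:ℝ) 1 :=
    (e1.filter_mono inf_le_left).prod_mk (Ioo_mem_nhdsGT one_pos)
  filter_upwards [ev] with q hq
  obtain ⟨h1, h2, h3⟩ := hq
  refine (iInf₂_le w (Metric.mem_ball_self hδ)).trans ?_
  norm_cast
  rw [← div_eq_mul_inv, div_le_iff₀ h2]
  have := hc.2 (Set.mem_univ q.1) (Set.mem_univ (q.1 + w)) (sub_nonneg.2 h3.le) h2.le (by ring)
  rw [show (1 - q.2) • q.1 + q.2 • (q.1 + w) = q.1 + q.2 • w by module] at this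
  simp only [smul_eq_mul] at this
  nlinarith

/-- The Separation Principle for a real-valued convex Lipschitz function, with the subgradient of
the latter expressed through the subgradient inequality. -/
theorem Subdifferential.exists_mem_hatSubdiff {X : Type*} [NormedAddCommGroup X] [NormedSpace ℝ X]
    (D : Subdifferential X) {f : X → EReal} (hf : ProperLsc f) {φ : X → ℝ}
    (hc : ConvexOn ℝ Set.univ φ) {K : ℝ} (hK : ∀ y z, φ y ≤ φ z + K * ‖y - z‖) (hφ : Continuous φ)
    {v : X} (hv : f v ≠ ⊤) (hmin : ∀ᶠ y in 𝓝 v, f v + φ v ≤ f y + φ y) :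
    ∃ p ∈ hatSubdiff (D.sub f) f v, ∀ w, -p w ≤ φ (v + w) - φ v := by
  have hφp : ProperLsc fun z => (φ z : EReal) :=
    ⟨(continuous_coe_real_ereal.comp hφ).lowerSemicontinuous, ⟨v, EReal.coe_ne_top _⟩,
      fun _ => EReal.coe_ne_bot _⟩
  obtain ⟨p₁, hp₁, p₂, hp₂, h⟩ := D.separation f (fun z => (φ z : EReal)) v hf hφp
    (fun x y a b ha hb hab => by
      have := hc.2 (Set.mem_univ x) (Set.mem_univ y) ha hb hab
      simp only [smul_eq_mul] at this
      beta_reduce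
      exact_mod_cast this)
    ⟨K, 1, one_pos, fun _ _ => ⟨EReal.coe_ne_top _, EReal.coe_ne_bot _⟩,
      fun y _ z _ => by have := hK y z; beta_reduce; exact_mod_cast this⟩ hv hmin
  refine ⟨p₁, hp₁, fun w => ?_⟩
  have h2 := le_sub_of_mem_clarkeSubdiff hφ hc (D.subset_clarke _ hφp v hp₂) w
  have h3 : p₁ w + p₂ w = 0 := by rw [← add_apply, h]; rfl
  linarith

/-- A functional in `∂̂f(v)` is approximated by subgradients at points `z` near `v`, tested in
directions pointing towards `x`. -/
theorem exists_mem_of_mem_hatSubdiff {X : Type*} [NormedAddCommGroup X] [NormedSpace ℝ X]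
    {S : X → Set (X →L[ℝ] ℝ)} {f : X → EReal} {v x u : X} {p : X →L[ℝ] ℝ}
    (hp : p ∈ hatSubdiff S f v) {α : ℝ} (hα : 0 ≤ α) {U : Set X} (hU : U ∈ 𝓝 v) {c : ℝ}
    (hc : c < p (u + α • (x - v))) : ∃ z ∈ U, ∃ q ∈ S z, c < q (u + α • (x - z)) := by
  obtain ⟨l, _, hS, hx, -, hw, hlim⟩ := hp
  set ε := (p (u + α • (x - v)) - c) / 2 with hε
  have hε0 : 0 < ε := by linarith
  have e1 := (hw (u + α • (x - v))).eventually_const_lt (show c + ε < _ by linarith)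
  have e2 := eventually_lt_of_limsup_lt
    (hlim.trans_lt (EReal.coe_pos.2 (show 0 < ε / (α + 1) by positivity)))
  obtain ⟨⟨z, q⟩, hq, hz, h1, h2⟩ := (hS.and ((hx.eventually_mem hU).and (e1.and e2))).exists
  refine ⟨z, hz, q, hq, ?_⟩
  simp only [EReal.coe_lt_coe_iff] at h1 h2
  rw [lt_div_iff₀ (by positivity)] at h2
  have : q (u + α • (x - z)) = q (u + α • (x - v)) - α * q (z - v) := by
    simp only [map_add, map_smul, map_sub, smul_eq_mul]; ring
  rw [this]
  rcases le_or_gt 0 (q (z - v)) with h | h <;> nlinarith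

/-- If `f - P` attains its minimum over the compact convex set `S` at `x₀`, then near `x₀` there are
subgradients of `f` dominating `P` in the directions `u + α (x - ·)` which point into `S`. -/
theorem exists_subgradient_of_isMinOn {X : Type*} [NormedAddCommGroup X] [NormedSpace ℝ X]
    [CompleteSpace X] (D : Subdifferential X) {f : X → EReal} (hf : ProperLsc f) {S : Set X}
    (hS : IsCompact S) (hconv : Convex ℝ S) {x₀ : X} (hx₀ : x₀ ∈ S) {m : ℝ} (hm : f x₀ = m)
    (P : X →L[ℝ] ℝ) (hmin : ∀ z ∈ S, ((m + P (z - x₀) : ℝ) : EReal) ≤ f z) {x u : X} {α ρ : ℝ}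
    (hα : 0 ≤ α) (hρ : 0 < ρ)
    (hdir : ∀ q ∈ S, ‖q - x₀‖ < ρ →
      ∃ θ : ℝ, 0 < θ ∧ θ * α ≤ 1 ∧ q + θ • (u + α • (x - q)) ∈ S)
    {U : Set X} (hU : U ∈ 𝓝 x₀) {c : ℝ} (hc : c < P (u + α • (x - x₀))) :
    ∃ z ∈ U, ∃ q ∈ D.sub f z, c < q (u + α • (x - z)) := by
  have hne : S.Nonempty := ⟨x₀, hx₀⟩
  obtain ⟨c', hcc', hc'⟩ := exists_between hc
  have hlow : LowerSemicontinuous fun z => f z + ((-P (z - x₀) : ℝ) : EReal) :=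
    hf.1.add' (continuous_coe_real_ereal.comp (by fun_prop)).lowerSemicontinuous
      fun z => EReal.continuousAt_add (Or.inr (EReal.coe_ne_bot _)) (Or.inr (EReal.coe_ne_top _))
  have hiff : ∀ (a : ℝ) z, ((a : EReal) < f z + ((-P (z - x₀) : ℝ) : EReal)) ↔
      ((a + P (z - x₀) : ℝ) : EReal) < f z := by
    intro a z
    generalize f z = b
    induction b with
    | bot => simp
    | top => simp only [EReal.top_add_coe, EReal.coe_lt_top]
    | coe b => norm_cast; constructor <;> intro h <;> linarith
  have hopen : ∀ a : ℝ, IsOpen {z | ((a + P (z - x₀) : ℝ) : EReal) < f z} := by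
    intro a
    simp_rw [← hiff]
    exact hlow.isOpen_preimage a
  obtain ⟨r, hr, hball⟩ : ∃ r > 0, Metric.closedBall x₀ r ⊆
      interior U ∩ {z | ((m - 1 + P (z - x₀) : ℝ) : EReal) < f z} ∩
        {z | c' < P (u + α • (x - z))} ∩ Metric.ball x₀ (ρ / 2) := by
    refine Metric.nhds_basis_closedBall.mem_iff.1 (inter_mem (inter_mem (inter_mem
      (interior_mem_nhds.2 hU) ((hopen _).mem_nhds ?_)) ?_) (Metric.ball_mem_nhds _ (by positivity)))
    · simp [hm]; norm_cast; linarith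
    · exact (by fun_prop : Continuous fun z => P (u + α • (x - z))).continuousAt.eventually_const_lt
        hc'
  obtain ⟨η, hη, hηw⟩ : ∃ η > 0, η * (‖u‖ + α * (‖x - x₀‖ + r)) < c' - c := by
    have hB : 0 ≤ ‖u‖ + α * (‖x - x₀‖ + r) := by positivity
    refine ⟨(c' - c) / (‖u‖ + α * (‖x - x₀‖ + r) + 1), by have := sub_pos.2 hcc'; positivity, ?_⟩
    rw [div_mul_eq_mul_div, div_lt_iff₀ (by positivity)]
    nlinarith
  obtain ⟨r', hr', htube⟩ := hS.exists_thickening_subset_open (hopen (m - η * r / 2)) (fun z hz => by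
    refine lt_of_lt_of_le ?_ (hmin z hz)
    norm_cast
    nlinarith [mul_pos hη hr])
  set ψ : X → ℝ := fun z => -P (z - x₀) + r'⁻¹ * Metric.infDist z S with hψ
  have hψc : Continuous ψ := by
    have := Metric.continuous_infDist_pt S
    fun_prop
  have hψ0 : ψ x₀ = 0 := by simp [hψ, Metric.infDist_zero_of_mem hx₀]
  have hFl : LowerSemicontinuous fun z => f z + (ψ z : EReal) :=
    hf.1.add' (continuous_coe_real_ereal.comp hψc).lowerSemicontinuous
      fun z => EReal.continuousAt_add (Or.inr (EReal.coe_ne_bot _)) (Or.inr (EReal.coe_ne_top _))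
  have hFlow : ∀ z ∈ Metric.closedBall x₀ r, ((m - η * r / 2 : ℝ) : EReal) ≤ f z + (ψ z : EReal) := by
    intro z hz
    have key : ∃ a : ℝ, ((a + P (z - x₀) : ℝ) : EReal) < f z ∧
        m - η * r / 2 ≤ a + r'⁻¹ * Metric.infDist z S := by
      by_cases hd : Metric.infDist z S < r'
      · refine ⟨_, htube ((Metric.mem_thickening_iff_infDist_lt hne).2 hd), ?_⟩
        have := Metric.infDist_nonneg (x := z) (s := S)
        have : 0 ≤ r'⁻¹ * Metric.infDist z S := by positivity
        linarith
      · refine ⟨_, (hball hz).1.1.2, ?_⟩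
        have : 1 ≤ r'⁻¹ * Metric.infDist z S := by
          rw [inv_mul_eq_div, le_div_iff₀ hr']; linarith [not_lt.1 hd]
        nlinarith [mul_pos hη hr]
    obtain ⟨a, h1, h2⟩ := key
    refine le_trans ?_ (add_le_add_left h1.le _)
    norm_cast
    simp only [hψ]; linarith
  set A : Set X := Metric.closedBall x₀ r ∩ {z | f z + (ψ z : EReal) ≤ m} with hA
  have hAcl : IsClosed A := Metric.isClosed_closedBall.inter (hFl.isClosed_preimage m)
  have hreal : ∀ z ∈ A, ((f z + (ψ z : EReal)).toReal : EReal) = f z + (ψ z : EReal) := fun z hz =>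
    EReal.coe_toReal (ne_top_of_le_ne_top (EReal.coe_ne_top m) hz.2)
      (ne_bot_of_le_ne_bot (EReal.coe_ne_bot _) (hFlow z hz.1))
  have hx₀A : x₀ ∈ A := ⟨Metric.mem_closedBall_self hr.le, by simp [hψ0, hm]⟩
  have : CompleteSpace A := hAcl.completeSpace_coe
  obtain ⟨⟨v, hvA⟩, hv1, hv2⟩ := ekeland (Y := A) (h := fun z => (f z + (ψ z : EReal)).toReal)
    (lowerSemicontinuous_iff_isClosed_preimage.2 fun y => by
      refine (congrArg IsClosed (Set.ext fun z => ?_)).mpr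
        ((hFl.isClosed_preimage y).preimage (continuous_subtype_val (p := (· ∈ A))))
      simp only [Set.mem_preimage, Set.mem_Iic]
      rw [← hreal z z.2, EReal.coe_le_coe_iff, EReal.toReal_coe])
    ⟨m - η * r / 2, by
      rintro _ ⟨z, rfl⟩
      exact EReal.coe_le_coe_iff.1 ((hFlow z z.2.1).trans_eq (hreal z z.2).symm)⟩
    ⟨x₀, hx₀A⟩ hη
  simp only [Subtype.dist_eq, Subtype.forall] at hv1 hv2
  have hvr : dist v x₀ ≤ r / 2 := by
    have h1 := EReal.coe_le_coe_iff.1 ((hFlow v hvA.1).trans_eq (hreal v hvA).symm)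
    rw [hψ0, hm, EReal.coe_zero, add_zero, EReal.toReal_coe] at hv1
    by_contra! h
    nlinarith
  have hfv : f v ≠ ⊤ := fun h => by
    have := hvA.2
    simp [h] at this
  have hvU := hball hvA.1
  obtain ⟨p, hp, hpw⟩ := D.exists_mem_hatSubdiff hf (φ := fun z => ψ z + η * dist z v)
    (K := ‖P‖ + r'⁻¹ + η) (v := v)
    (by
      refine ConvexOn.add (ConvexOn.add ?_ ?_) ?_
      · refine ⟨convex_univ, fun y _ z _ a b _ _ hab => le_of_eq ?_⟩
        obtain rfl : b = 1 - a := by linarith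
        simp only [map_sub, map_add, map_smul, smul_eq_mul]; ring
      · exact (hS.convexOn_infDist hne hconv).smul (inv_nonneg.2 hr'.le)
      · exact (convexOn_univ_dist v).smul hη.le)
    (by
      intro y z
      have h1 : P (z - x₀) - P (y - x₀) ≤ ‖P‖ * ‖y - z‖ := by
        rw [← map_sub, sub_sub_sub_cancel_right, norm_sub_rev]
        exact (le_abs_self _).trans (P.le_opNorm _)
      have h2 : r'⁻¹ * Metric.infDist y S ≤ r'⁻¹ * (Metric.infDist z S + ‖y - z‖) := by
        rw [← dist_eq_norm]; gcongr; exact Metric.infDist_le_infDist_add_dist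
      have h3 : η * dist y v ≤ η * (‖y - z‖ + dist z v) := by
        rw [← dist_eq_norm]; gcongr; exact dist_triangle _ _ _
      simp only [hψ]; linarith)
    (by fun_prop) hfv
    (by
      filter_upwards [Metric.closedBall_mem_nhds v (half_pos hr)] with y hy
      have hyb : y ∈ Metric.closedBall x₀ r := by
        rw [Metric.mem_closedBall] at hy ⊢
        linarith [dist_triangle y v x₀]
      rw [dist_self, mul_zero, add_zero, EReal.coe_add (ψ y), ← add_assoc]
      by_cases hyA : y ∈ A
      · have := hv2 y hyA
        rw [← hreal v hvA, ← hreal y hyA]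
        exact_mod_cast this
      · have hlt : (m : EReal) < f y + ψ y := not_le.1 fun h => hyA ⟨hyb, h⟩
        refine (hvA.2.trans hlt.le).trans (le_add_of_nonneg_right ?_)
        exact_mod_cast mul_nonneg hη.le dist_nonneg)
  refine exists_mem_of_mem_hatSubdiff hp hα (mem_interior_iff_mem_nhds.1 hvU.1.1.1) ?_
  obtain ⟨q, hqS, hq⟩ := hS.exists_infDist_eq_dist hne v
  have hqx : ‖q - x₀‖ < ρ := by
    have h1 := Metric.infDist_le_dist_of_mem (x := v) hx₀
    have h2 : dist v x₀ < ρ / 2 := hvU.2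
    rw [← dist_eq_norm]
    linarith [dist_triangle q v x₀, dist_comm q v]
  obtain ⟨θ, hθ, hθα, hθS⟩ := hdir q hqS hqx
  set w := u + α • (x - v) with hw
  have hdist : Metric.infDist (v + θ • w) S ≤ Metric.infDist v S := by
    refine (Metric.infDist_le_dist_of_mem hθS).trans ?_
    rw [hq, dist_eq_norm, dist_eq_norm]
    calc ‖v + θ • w - (q + θ • (u + α • (x - q)))‖ = ‖(1 - θ * α) • (v - q)‖ := by
          rw [hw]; congr 1; module
      _ = (1 - θ * α) * ‖v - q‖ := by rw [norm_smul, Real.norm_of_nonneg (by linarith)]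
      _ ≤ ‖v - q‖ := mul_le_of_le_one_left (norm_nonneg _) (by nlinarith)
  have hwn : ‖w‖ ≤ ‖u‖ + α * (‖x - x₀‖ + r) := by
    refine (norm_add_le _ _).trans ?_
    rw [norm_smul, Real.norm_of_nonneg hα]
    gcongr
    rw [← sub_add_sub_cancel x x₀ v]
    refine (norm_add_le _ _).trans ?_
    rw [← dist_eq_norm x₀ v, dist_comm]
    linarith
  have h1 := hpw (θ • w)
  have h2 : r'⁻¹ * Metric.infDist (v + θ • w) S ≤ r'⁻¹ * Metric.infDist v S := by gcongr
  have h3 : c' < P w := hvU.1.2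
  have h4 : -(θ * p w) ≤ -(θ * P w) + η * (θ * ‖w‖) := by
    simp only [hψ, dist_self, map_sub, map_add, map_smul, smul_eq_mul] at h1
    rw [dist_eq_norm, add_sub_cancel_left, norm_smul, Real.norm_of_nonneg hθ.le] at h1
    linarith
  have h5 : P w - η * ‖w‖ ≤ p w := by
    refine le_of_mul_le_mul_left ?_ hθ
    linarith
  nlinarith

/-- If `f` increases at rate more than `c₂` along a piece of the ray from `x` in the direction `u`,
there are subgradients close to that piece which are more than about `c₂` in the directions
`u + α (x - ·)`. -/
theorem exists_subgradient_of_lt_slope {X : Type*} [NormedAddCommGroup X] [NormedSpace ℝ X]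
    [CompleteSpace X] (D : Subdifferential X) {f : X → EReal} (hf : ProperLsc f) {x u : X}
    (hu : u ≠ 0) {a b α k c₂ : ℝ} (ha : 0 ≤ a) (hab : a < b) (hα : 0 ≤ α) (hαb : α * b ≤ 1)
    (hfa : f (x + a • u) ≤ k) (hlt : ((k + c₂ * (b - a) : ℝ) : EReal) < f (x + b • u)) :
    ∃ s ∈ Set.Ico a b, ∀ U ∈ 𝓝 (x + s • u), ∀ c < c₂ * (1 - α * s),
      ∃ z ∈ U, ∃ q ∈ D.sub f z, c < q (u + α • (x - z)) := by
  obtain ⟨g, -, hg⟩ := exists_dual_vector ℝ u (norm_ne_zero_iff.2 hu)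
  obtain ⟨P, hP⟩ : ∃ P : X →L[ℝ] ℝ, P u = c₂ :=
    ⟨(c₂ / ‖u‖) • g, by
      simp [hg, div_mul_cancel₀ _ (norm_ne_zero_iff.2 hu)]⟩
  have hlow : LowerSemicontinuous fun s : ℝ => f (x + s • u) + ((-(c₂ * s) : ℝ) : EReal) :=
    (LowerSemicontinuous.comp hf.1 (by fun_prop)).add'
      (continuous_coe_real_ereal.comp (by fun_prop)).lowerSemicontinuous
      fun z => EReal.continuousAt_add (Or.inr (EReal.coe_ne_bot _)) (Or.inr (EReal.coe_ne_top _))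
  obtain ⟨s₀, hs₀, hmin⟩ := (hlow.lowerSemicontinuousOn _).exists_isMinOn
    (Set.nonempty_Icc.2 hab.le) isCompact_Icc
  have hmin' : ∀ s ∈ Set.Icc a b, f (x + s₀ • u) + ((-(c₂ * s₀) : ℝ) : EReal)
    ≤ f (x + s • u) + ((-(c₂ * s) : ℝ) : EReal) := fun s hs => hmin hs
  obtain ⟨m₁, hm₁⟩ : ∃ m₁ : ℝ, f (x + a • u) = m₁ :=
    ⟨_, (EReal.coe_toReal (ne_top_of_le_ne_top (EReal.coe_ne_top k) hfa) (hf.2.2 _)).symm⟩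
  have hm₁k : m₁ ≤ k := by simpa [hm₁] using hfa
  have h₀a := hmin' a ⟨le_rfl, hab.le⟩
  obtain ⟨m, hm⟩ : ∃ m : ℝ, f (x + s₀ • u) = m := by
    refine ⟨_, (EReal.coe_toReal (fun h => ?_) (hf.2.2 _)).symm⟩
    rw [h, hm₁, EReal.top_add_coe] at h₀a
    exact absurd h₀a (not_le.2 (by exact_mod_cast EReal.coe_lt_top _))
  have hmin'' : ∀ s ∈ Set.Icc a b, ((m + c₂ * (s - s₀) : ℝ) : EReal) ≤ f (x + s • u) := by
    intro s hs
    have := hmin' s hs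
    rw [hm] at this
    generalize f (x + s • u) = y at this
    induction y with
    | bot =>
      rw [EReal.bot_add] at this
      exact absurd this (not_le.2 (by exact_mod_cast EReal.bot_lt_coe _))
    | top => exact le_top
    | coe y => norm_cast at this ⊢; linarith
  have hs₀b : s₀ < b := by
    refine lt_of_le_of_ne hs₀.2 fun h => ?_
    rw [hm₁, hm] at h₀a
    rw [← h, hm] at hlt
    norm_cast at h₀a hlt
    linarith
  refine ⟨s₀, ⟨hs₀.1, hs₀b⟩, fun U hU c hc => ?_⟩
  have hun : 0 < ‖u‖ := norm_pos_iff.2 hu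
  refine exists_subgradient_of_isMinOn D hf (S := (fun s : ℝ => x + s • u) '' Set.Icc a b)
    (isCompact_Icc.image (by fun_prop)) ?_ ⟨s₀, hs₀, rfl⟩ hm P ?_ hα
    (mul_pos (sub_pos.2 hs₀b) hun) ?_ hU ?_
  · rintro _ ⟨s, hs, rfl⟩ _ ⟨t, ht, rfl⟩ p q hp hq hpq
    refine ⟨p • s + q • t, convex_Icc a b hs ht hp hq hpq, ?_⟩
    obtain rfl : q = 1 - p := by linarith
    simp only [smul_eq_mul]
    module
  · rintro _ ⟨s, hs, rfl⟩
    refine (hmin'' s hs).trans_eq' ?_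
    simp only [add_sub_add_left_eq_sub, ← sub_smul, map_smul, hP, smul_eq_mul]
    rw [mul_comm]
  · rintro _ ⟨s, hs, rfl⟩ hq
    simp only [add_sub_add_left_eq_sub, ← sub_smul, norm_smul, Real.norm_eq_abs] at hq
    have hsb : s < b := by
      have := (le_abs_self _).trans_lt (lt_of_mul_lt_mul_right hq hun.le)
      linarith
    have hs0 : 0 ≤ α * s := mul_nonneg hα (ha.trans hs.1)
    have hs1 : α * s ≤ 1 := (mul_le_mul_of_nonneg_left hs.2 hα).trans hαb
    have hα1 : 0 < 1 / (α + 1) := by positivity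
    refine ⟨min (b - s) (1 / (α + 1)), lt_min (sub_pos.2 hsb) hα1, ?_,
      s + min (b - s) (1 / (α + 1)) * (1 - α * s), ⟨?_, ?_⟩, by module⟩
    · calc min (b - s) (1 / (α + 1)) * α ≤ 1 / (α + 1) * α := by gcongr; exact min_le_right _ _
        _ ≤ 1 := by rw [one_div_mul_eq_div, div_le_one (by positivity)]; linarith
    · have := mul_nonneg (lt_min (sub_pos.2 hsb) hα1).le (sub_nonneg.2 hs1)
      linarith [hs.1]
    · have := mul_le_of_le_one_right (lt_min (sub_pos.2 hsb) hα1).le (show 1 - α * s ≤ 1 by linarith)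
      linarith [min_le_left (b - s) (1 / (α + 1))]
  · rw [sub_add_cancel_left, map_add, map_smul, map_neg, map_smul, hP]
    simp only [smul_eq_mul]
    linarith

theorem eventually_lt_of_lt_radialSub {X : Type*} [NormedAddCommGroup X] [NormedSpace ℝ X]
    {f : X → EReal} {x u : X} {m c : ℝ} (hm : f x = m) (hc : (c : EReal) < radialSub f x u) :
    ∀ᶠ t in 𝓝[>] (0:ℝ), ((m + c * t : ℝ) : EReal) < f (x + t • u) := by
  filter_upwards [eventually_lt_of_lt_liminf hc, eventually_mem_nhdsWithin] with t ht ht0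
  rwa [erSlope, hm, lt_slope_iff ht0] at ht

theorem radialSub_le_of_forall_supportSub_le {X : Type*} [NormedAddCommGroup X] [NormedSpace ℝ X]
    [CompleteSpace X] (D : Subdifferential X) {f : X → EReal} (hf : ProperLsc f) {xbar u x : X}
    {α : ℝ} (hα : 0 ≤ α) {U : Set X} (hU : U ∈ 𝓝 x) {M : EReal}
    (hM : ∀ z ∈ U, supportSub (D.sub f) z (u + α • (xbar - z)) ≤ M) :
    radialSub f x (u + α • (xbar - x)) ≤ M := by
  rcases eq_or_ne (f x) ⊤ with htop | hntop
  · refine le_of_eq_of_le ?_ bot_le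
    rw [radialSub, liminf_congr (v := fun _ => ⊥), liminf_const]
    filter_upwards [eventually_mem_nhdsWithin] with t ht
    rw [erSlope, htop, slope_top ht]
  obtain ⟨m, hm⟩ : ∃ m : ℝ, f x = m := ⟨_, (EReal.coe_toReal hntop (hf.2.2 x)).symm⟩
  refine EReal.ge_of_forall_gt_iff_ge.1 fun c hc => ?_
  set w := u + α • (xbar - x) with hw
  have hwz : ∀ z, u + α • (xbar - z) = w + α • (x - z) := fun z => by rw [hw]; module
  simp only [hwz] at hM
  suffices ∃ z ∈ U, ∃ q ∈ D.sub f z, c < q (w + α • (x - z)) by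
    obtain ⟨z, hz, q, hq, hcq⟩ := this
    exact (EReal.coe_le_coe_iff.2 hcq.le).trans ((le_iSup₂ (f := fun p (_ : p ∈ D.sub f z) =>
      ((p (w + α • (x - z)) : ℝ) : EReal)) q hq).trans (hM z hz))
  obtain ⟨c₂, hcc₂, hc₂⟩ := EReal.lt_iff_exists_real_btwn.1 hc
  rw [EReal.coe_lt_coe_iff] at hcc₂
  have hev := eventually_lt_of_lt_radialSub hm hc₂
  rcases eq_or_ne w 0 with hw0 | hw0
  · obtain ⟨t, ht, ht0⟩ := (hev.and eventually_mem_nhdsWithin).exists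
    rw [hw0, smul_zero, add_zero, hm, EReal.coe_lt_coe_iff] at ht
    have hc₂0 : c₂ < 0 := by
      by_contra! h
      nlinarith [mul_nonneg h (le_of_lt ht0)]
    refine exists_subgradient_of_isMinOn D hf (isCompact_singleton (x := x)) (convex_singleton x)
      rfl hm 0 (by simp [hm]) hα one_pos ?_ hU (by simpa using hcc₂.trans hc₂0)
    rintro q rfl -
    refine ⟨1 / (α + 1), by positivity, ?_, by simp [hw0]⟩
    rw [one_div_mul_eq_div, div_le_one (by positivity)]
    linarith
  · have e1 : ∀ᶠ b in 𝓝 (0:ℝ), α * b < 1 :=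
      (by fun_prop : Continuous fun b : ℝ => α * b).continuousAt.eventually_lt_const (by simp)
    have e2 : ∀ᶠ b in 𝓝 (0:ℝ), U ∈ 𝓝 (x + b • w) :=
      ((by fun_prop : Continuous fun b : ℝ => x + b • w).tendsto' 0 x (by simp)).eventually
        (eventually_mem_nhds_iff.2 hU)
    have e3 : ∀ᶠ b in 𝓝 (0:ℝ), c < c₂ * (1 - α * b) :=
      (by fun_prop : Continuous fun b : ℝ => c₂ * (1 - α * b)).continuousAt.eventually_const_lt
        (by simpa using hcc₂)
    obtain ⟨r, hr, hball⟩ := Metric.eventually_nhds_iff.1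
      (e1.and (e2.and e3))
    obtain ⟨b, hb, hb0⟩ := (hev.and (Ioo_mem_nhdsGT hr)).exists
    have hnear : ∀ s ∈ Set.Icc 0 b, dist s 0 < r := fun s hs => by
      rw [Real.dist_0_eq_abs, abs_of_nonneg hs.1]; exact hs.2.trans_lt hb0.2
    obtain ⟨s, hs, H⟩ := exists_subgradient_of_lt_slope D hf (x := x) hw0 le_rfl hb0.1 hα
      (hball (hnear b ⟨hb0.1.le, le_rfl⟩)).1.le (k := m) (c₂ := c₂) (by simp [hm]) (by simpa using hb)
    have := hball (hnear s ⟨hs.1, hs.2.le⟩)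
    exact H U this.2.1 c this.2.2

theorem cone_mem_nhds {X : Type*} [NormedAddCommGroup X] [NormedSpace ℝ X] {x v v' : X} {t δ : ℝ}
    (ht : t ≠ 0) (hv : v' ∈ Metric.ball v δ) :
    {z | t⁻¹ • (z - x) ∈ Metric.ball v δ} ∈ 𝓝 (x + t • v') := by
  refine (by fun_prop : Continuous fun z => t⁻¹ • (z - x)).continuousAt.preimage_mem_nhds
    (Metric.isOpen_ball.mem_nhds ?_)
  rwa [add_sub_cancel_left, inv_smul_smul₀ ht]

theorem le_iSup_cone {X : Type*} [NormedAddCommGroup X] [NormedSpace ℝ X] (k : X → EReal)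
    {x v z : X} {t δ : ℝ} (ht : t ∈ Set.Ioo 0 δ) (hz : t⁻¹ • (z - x) ∈ Metric.ball v δ) :
    k z ≤ ⨆ t ∈ Set.Ioo (0:ℝ) δ, ⨆ v' ∈ Metric.ball v δ, k (x + t • v') := by
  refine le_trans (le_of_eq ?_) (le_iSup₂_of_le t ht (le_iSup₂_of_le _ hz le_rfl))
  rw [smul_inv_smul₀ ht.1.ne', add_sub_cancel]

theorem dirLimsup_le_dirLimsup {X : Type*} [NormedAddCommGroup X] [NormedSpace ℝ X]
    {h k : X → EReal} {x v : X}
    (H : ∀ y, ∀ U ∈ 𝓝 y, ∀ M, (∀ z ∈ U, k z ≤ M) → h y ≤ M) :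
    dirLimsup h x v ≤ dirLimsup k x v :=
  iInf₂_mono fun _ _ => iSup₂_le fun _ ht => iSup₂_le fun _ hv =>
    H _ _ (cone_mem_nhds ht.1.ne' hv) _ fun _ hz => le_iSup_cone k ht hz

theorem dirLimsup_radialSub_eq {X : Type*} [NormedAddCommGroup X] [NormedSpace ℝ X]
    [CompleteSpace X] (D : Subdifferential X) {f : X → EReal} (hf : ProperLsc f) (xbar u : X)
    {α : ℝ} (hα : 0 ≤ α) :
    dirLimsup (fun x => radialSub f x (u + α • (xbar - x))) xbar u =
      dirLimsup (fun x => supportSub (D.sub f) x (u + α • (xbar - x))) xbar u :=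
  le_antisymm
    (dirLimsup_le_dirLimsup fun _ _ hU _ hM => radialSub_le_of_forall_supportSub_le D hf hα hU hM)
    (dirLimsup_le_dirLimsup fun _ _ hU _ hM => supportSub_le_of_forall_radialSub_le D hf hU hM)

theorem RadiallyAccessible.radialSub_le_dirLimsup {X : Type*} [NormedAddCommGroup X]
    [NormedSpace ℝ X] [CompleteSpace X] (D : Subdifferential X) {f : X → EReal} (hf : ProperLsc f)
    {xbar u : X} (hacc : RadiallyAccessible f xbar u) (hxbar : f xbar ≠ ⊤) (hu : u ≠ 0)
    {α : ℝ} (hα : 0 ≤ α) :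
    radialSub f xbar u ≤
      dirLimsup (fun x => supportSub (D.sub f) x (u + α • (xbar - x))) xbar u := by
  refine EReal.ge_of_forall_gt_iff_ge.1 fun c hc => le_iInf₂ fun δ hδ => ?_
  obtain ⟨m, hm⟩ : ∃ m : ℝ, f xbar = m := ⟨_, (EReal.coe_toReal hxbar (hf.2.2 _)).symm⟩
  obtain ⟨c₂, hcc₂, hc₂⟩ := EReal.lt_iff_exists_real_btwn.1 hc
  rw [EReal.coe_lt_coe_iff] at hcc₂
  have e1 : ∀ᶠ b in 𝓝 (0:ℝ), α * b < 1 :=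
    (by fun_prop : Continuous fun b : ℝ => α * b).continuousAt.eventually_lt_const (by simp)
  have e2 : ∀ᶠ b in 𝓝 (0:ℝ), c < c₂ * (1 - α * b) :=
    (by fun_prop : Continuous fun b : ℝ => c₂ * (1 - α * b)).continuousAt.eventually_const_lt
      (by simpa using hcc₂)
  obtain ⟨r, hr, hball⟩ := Metric.eventually_nhds_iff.1 (e1.and e2)
  obtain ⟨b, hb, hb0, hbr⟩ := ((eventually_lt_of_lt_radialSub hm hc₂).and
    (Ioo_mem_nhdsGT (lt_min hr hδ))).exists
  have hnear : ∀ s ∈ Set.Icc 0 b, dist s 0 < r := fun s hs => by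
    rw [Real.dist_0_eq_abs, abs_of_nonneg hs.1]
    exact hs.2.trans_lt (hbr.trans_le (min_le_left _ _))
  obtain ⟨κ, hκ, hκb⟩ := EReal.lt_iff_exists_real_btwn.1 hb
  rw [EReal.coe_lt_coe_iff] at hκ
  set η := (κ - (m + c₂ * b)) / 2 with hη
  have hη0 : 0 < η := by linarith
  have hfr : ∃ᶠ a in 𝓝[>] (0:ℝ), f (xbar + a • u) < ((m + η : ℝ) : EReal) := by
    refine frequently_lt_of_liminf_lt (h := ?_)
    rw [← hacc, hm, EReal.coe_lt_coe_iff]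
    linarith
  have e3 : ∀ᶠ a in 𝓝[>] (0:ℝ), -(c₂ * a) < η :=
    ((by fun_prop : Continuous fun a : ℝ => -(c₂ * a)).continuousAt.eventually_lt_const
      (by simpa using hη0)).filter_mono nhdsWithin_le_nhds
  obtain ⟨a, hfa, ha3, ha0, hab⟩ := (hfr.and_eventually (e3.and (Ioo_mem_nhdsGT hb0))).exists
  obtain ⟨s, hs, H⟩ := exists_subgradient_of_lt_slope D hf hu ha0.le hab hα
    (hball (hnear b ⟨hb0.le, le_rfl⟩)).1.le (c₂ := c₂) hfa.le
    (lt_of_lt_of_le (EReal.coe_lt_coe_iff.2 (by linarith)) hκb.le)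
  have hs0 : 0 < s := ha0.trans_le hs.1
  obtain ⟨z, hz, q, hq, hcq⟩ := H _ (cone_mem_nhds hs0.ne' (Metric.mem_ball_self hδ)) c
    (hball (hnear s ⟨hs0.le, hs.2.le⟩)).2
  exact (EReal.coe_le_coe_iff.2 hcq.le).trans ((le_iSup₂ (f := fun p (_ : p ∈ D.sub f z) =>
    ((p (u + α • (xbar - z)) : ℝ) : EReal)) q hq).trans
    (le_iSup_cone (fun x => supportSub (D.sub f) x (u + α • (xbar - x)))
      ⟨hs0, hs.2.trans (hbr.trans_le (min_le_right _ _))⟩ hz))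

/-- **Recovering the radial subderivative from a subdifferential (directional version).** -/
theorem recover_radial_subderivative_directional
    {X : Type*} [NormedAddCommGroup X] [NormedSpace ℝ X] [CompleteSpace X]
    (D : Subdifferential X) (f : X → EReal) (hf : ProperLsc f)
    (xbar : X) (hxbar : f xbar ≠ ⊤) (u : X) (hu : u ≠ 0)
    (hacc : RadiallyAccessible f xbar u) :
    UpperSemismooth f xbar u ↔
      radialSub f xbar u
        = ⨅ α ∈ Set.Ici (0:ℝ),
            dirLimsup (fun x => supportSub (D.sub f) x (u + α • (xbar - x))) xbar u := by
  have hle : radialSub f xbar u ≤ ⨅ α ∈ Set.Ici (0:ℝ),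
      dirLimsup (fun x => supportSub (D.sub f) x (u + α • (xbar - x))) xbar u :=
    le_iInf₂ fun α hα => hacc.radialSub_le_dirLimsup D hf hxbar hu hα
  rw [UpperSemismooth, biInf_congr fun α (hα : α ∈ Set.Ici (0:ℝ)) =>
    dirLimsup_radialSub_eq D hf xbar u hα]
  exact ⟨hle.antisymm, fun h => h.ge⟩
end
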